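/- arXiv:0704.2600 — 2 statements merged into one kernel-verified Lean document; each statement's English description precedes it below -/
import Mathlib

section
/- Let x ∈ B_n with ℓ(x) > 1 be conjugate to a left rigid braid. Then the directed graphs USG_L(x) and USG_R(x)^op are isomorphic. -/
/-!
Axiomatization of Garside groups (positive cone, Garside element, lattice
structure, left/right normal forms), following the paper
"On the cycling operation in braid groups" by Gebhardt and González-Meneses.
-/

namespace Garside

variable {G : Type*} [Group G]

/-- `a ≼ b`: `a` is a left divisor (prefix) of `b` w.r.t. the positive cone `P`. -/
def LeftDvd (P : Submonoid G) (a b : G) : Prop := a⁻¹ * b ∈ P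

/-- `a` is a right divisor (suffix) of `b` w.r.t. the positive cone `P`
(i.e. `b ≽ a` in the notation of the paper). -/
def RightDvd (P : Submonoid G) (a b : G) : Prop := b * a⁻¹ ∈ P

/-- A simple element: a positive prefix of `Δ`. -/
def Simple (P : Submonoid G) (Δ : G) (s : G) : Prop := s ∈ P ∧ LeftDvd P s Δ

/-- An atom: a nontrivial positive element which is not the product
of two nontrivial positive elements. -/
def Atom (P : Submonoid G) (a : G) : Prop :=
  a ∈ P ∧ a ≠ 1 ∧ ∀ b c : G, b ∈ P → c ∈ P → a = b * c → b = 1 ∨ c = 1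

/-- `Δ^p x₁ ⋯ x_r` (with `l = [x₁,…,x_r]`) is the left normal form of `x`:
each factor is a proper simple element and consecutive factors are
left-weighted, `x_i = (x_i x_{i+1}) ∧_L Δ`. -/
def IsLeftNF (P : Submonoid G) (Δ : G) (gcdL : G → G → G) (p : ℤ) (l : List G) (x : G) :
    Prop :=
  x = Δ ^ p * l.prod ∧ (∀ s ∈ l, Simple P Δ s ∧ s ≠ 1 ∧ s ≠ Δ) ∧
    l.Chain' (fun s t => gcdL (s * t) Δ = s)

/-- `y₁ ⋯ y_r Δ^p` (with `l = [y₁,…,y_r]`) is the right normal form of `x`: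
each factor is a proper simple element and consecutive factors are
right-weighted, `y_{i+1} = (y_i y_{i+1}) ∧_R Δ`. -/
def IsRightNF (P : Submonoid G) (Δ : G) (gcdR : G → G → G) (p : ℤ) (l : List G) (x : G) :
    Prop :=
  x = l.prod * Δ ^ p ∧ (∀ s ∈ l, Simple P Δ s ∧ s ≠ 1 ∧ s ≠ Δ) ∧
    l.Chain' (fun s t => gcdR (s * t) Δ = t)

/-- A Garside structure on a group `G`: a positive cone which induces lattice
orders by left and right divisibility, and a Garside element `Δ` whose left and
right divisors coincide (the simple elements), generate the group, and such that
every element admits a unique left and right normal form. -/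
structure GarsideGroup (G : Type*) [Group G] where
  pos : Submonoid G
  pos_antisymm : ∀ a : G, a ∈ pos → a⁻¹ ∈ pos → a = 1
  Δ : G
  Δ_pos : Δ ∈ pos
  gcdL : G → G → G
  gcdL_dvd_left : ∀ a b : G, LeftDvd pos (gcdL a b) a
  gcdL_dvd_right : ∀ a b : G, LeftDvd pos (gcdL a b) b
  dvd_gcdL : ∀ a b c : G, LeftDvd pos c a → LeftDvd pos c b → LeftDvd pos c (gcdL a b)
  lcmL : G → G → G
  dvd_lcmL_left : ∀ a b : G, LeftDvd pos a (lcmL a b)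
  dvd_lcmL_right : ∀ a b : G, LeftDvd pos b (lcmL a b)
  lcmL_dvd : ∀ a b c : G, LeftDvd pos a c → LeftDvd pos b c → LeftDvd pos (lcmL a b) c
  gcdR : G → G → G
  gcdR_dvd_left : ∀ a b : G, RightDvd pos (gcdR a b) a
  gcdR_dvd_right : ∀ a b : G, RightDvd pos (gcdR a b) b
  dvd_gcdR : ∀ a b c : G, RightDvd pos c a → RightDvd pos c b → RightDvd pos c (gcdR a b)
  lcmR : G → G → G
  dvd_lcmR_left : ∀ a b : G, RightDvd pos a (lcmR a b)
  dvd_lcmR_right : ∀ a b : G, RightDvd pos b (lcmR a b)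
  lcmR_dvd : ∀ a b c : G, RightDvd pos a c → RightDvd pos b c → RightDvd pos (lcmR a b) c
  divisors_Δ : ∀ s : G, (s ∈ pos ∧ LeftDvd pos s Δ) ↔ (s ∈ pos ∧ RightDvd pos s Δ)
  simples_generate : Subgroup.closure {s : G | Simple pos Δ s} = ⊤
  lnf_exists : ∀ x : G, ∃ pl : ℤ × List G, IsLeftNF pos Δ gcdL pl.1 pl.2 x
  lnf_unique : ∀ (x : G) (p q : ℤ) (l m : List G),
    IsLeftNF pos Δ gcdL p l x → IsLeftNF pos Δ gcdL q m x → p = q ∧ l = m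
  rnf_exists : ∀ x : G, ∃ pl : ℤ × List G, IsRightNF pos Δ gcdR pl.1 pl.2 x
  rnf_unique : ∀ (x : G) (p q : ℤ) (l m : List G),
    IsRightNF pos Δ gcdR p l x → IsRightNF pos Δ gcdR q m x → p = q ∧ l = m
  lnf_rnf_agree : ∀ (x : G) (p q : ℤ) (l m : List G),
    IsLeftNF pos Δ gcdL p l x → IsRightNF pos Δ gcdR q m x → p = q ∧ l.length = m.length

/-- `L` is the left lcm of the set `S`. -/
def IsLcmL (P : Submonoid G) (S : Set G) (L : G) : Prop :=
  (∀ a ∈ S, LeftDvd P a L) ∧ ∀ c : G, (∀ a ∈ S, LeftDvd P a c) → LeftDvd P L c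

/-- A Garside group is atom-friendly (on the left) if `Δ` is the left lcm of the
set of atoms and the starting set of the left lcm of any set `B` of atoms is `B`. -/
def AtomFriendlyL (𝒢 : GarsideGroup G) : Prop :=
  IsLcmL 𝒢.pos {a : G | Atom 𝒢.pos a} 𝒢.Δ ∧
    ∀ B : Set G, B ⊆ {a : G | Atom 𝒢.pos a} →
      ∃ L : G, IsLcmL 𝒢.pos B L ∧ {a : G | Atom 𝒢.pos a ∧ LeftDvd 𝒢.pos a L} = B

namespace GarsideGroup

variable (𝒢 : GarsideGroup G)

/-- The left normal form of `x`, as a pair (infimum, list of factors). -/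
noncomputable def lnf (x : G) : ℤ × List G := Classical.choose (𝒢.lnf_exists x)

/-- The right normal form of `x`, as a pair (exponent of `Δ`, list of factors). -/
noncomputable def rnf (x : G) : ℤ × List G := Classical.choose (𝒢.rnf_exists x)

/-- `inf x = p`, the maximal `p` with `Δ^p ≼ x`. -/
noncomputable def inf (x : G) : ℤ := (𝒢.lnf x).1

/-- The canonical length `ℓ(x) = r`. -/
noncomputable def len (x : G) : ℕ := (𝒢.lnf x).2.length

/-- `sup x = p + r`. -/
noncomputable def sup (x : G) : ℤ := 𝒢.inf x + 𝒢.len x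

/-- `tau 𝒢 k x = τ^k(x) = Δ^{-k} x Δ^k`. -/
def tau (k : ℤ) (x : G) : G := 𝒢.Δ ^ (-k) * x * 𝒢.Δ ^ k

/-- The left initial factor `ι_L(x) = τ^{-p}(x₁)` (equal to `1` if `ℓ(x) = 0`). -/
noncomputable def iotaL (x : G) : G := 𝒢.tau (-(𝒢.lnf x).1) ((𝒢.lnf x).2.headD 1)

/-- The right initial factor `ι_R(x) = τ^{p}(y_r)` (equal to `1` if `ℓ(x) = 0`). -/
noncomputable def iotaR (x : G) : G := 𝒢.tau (𝒢.rnf x).1 (((𝒢.rnf x).2.getLast?).getD 1)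

/-- Left cycling: `c_L(x) = ι_L(x)⁻¹ · x · ι_L(x)`. -/
noncomputable def cL (x : G) : G := (𝒢.iotaL x)⁻¹ * x * 𝒢.iotaL x

/-- Right cycling: `c_R(x) = ι_R(x) · x · ι_R(x)⁻¹`. -/
noncomputable def cR (x : G) : G := 𝒢.iotaR x * x * (𝒢.iotaR x)⁻¹

/-- `x = Δ^p x₁⋯x_r` (in left normal form, `r > 0`) is left rigid if
`Δ^p x₁⋯x_r ι_L(x)` is in left normal form as written. -/
def LeftRigid (x : G) : Prop :=
  (𝒢.lnf x).2 ≠ [] ∧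
    IsLeftNF 𝒢.pos 𝒢.Δ 𝒢.gcdL (𝒢.lnf x).1 ((𝒢.lnf x).2 ++ [𝒢.iotaL x]) (x * 𝒢.iotaL x)

/-- `x = y₁⋯y_r Δ^p` (in right normal form, `r > 0`) is right rigid if
`ι_R(x) y₁⋯y_r Δ^p` is in right normal form as written. -/
def RightRigid (x : G) : Prop :=
  (𝒢.rnf x).2 ≠ [] ∧
    IsRightNF 𝒢.pos 𝒢.Δ 𝒢.gcdR (𝒢.rnf x).1 (𝒢.iotaR x :: (𝒢.rnf x).2) (𝒢.iotaR x * x)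

/-- The super summit set: conjugates of minimal canonical length. -/
def SSS (x : G) : Set G :=
  {y | IsConj x y ∧ ∀ z : G, IsConj x z → 𝒢.len y ≤ 𝒢.len z}

/-- The left ultra summit set. -/
def USSL (x : G) : Set G :=
  {y ∈ 𝒢.SSS x | ∃ t : ℕ, 1 ≤ t ∧ (𝒢.cL)^[t] y = y}

/-- The right ultra summit set. -/
def USSR (x : G) : Set G :=
  {y ∈ 𝒢.SSS x | ∃ t : ℕ, 1 ≤ t ∧ (𝒢.cR)^[t] y = y}

/-- `x` is periodically geodesic: `inf(x^m) = m inf(x)` and `sup(x^m) = m sup(x)`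
for all `m ≥ 1`. -/
def PeriodicallyGeodesic (x : G) : Prop :=
  ∀ m : ℕ, 1 ≤ m → 𝒢.inf (x ^ m) = (m : ℤ) * 𝒢.inf x ∧ 𝒢.sup (x ^ m) = (m : ℤ) * 𝒢.sup x

/-- The left interior `x°_L = x Δ^{-p}`, where `p = inf(x)`. -/
noncomputable def intL (x : G) : G := x * 𝒢.Δ ^ (-𝒢.inf x)

/-- The right interior `x°_R = Δ^{-p} x`, where `p = inf(x)`. -/
noncomputable def intR (x : G) : G := 𝒢.Δ ^ (-𝒢.inf x) * x

/-- The right transport of `v` (where `v x v⁻¹ = z`):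
`v^{(1)}_R = ι_R(z) · v · ι_R(x)⁻¹`. -/
noncomputable def transR (x v : G) : G := 𝒢.iotaR (v * x * v⁻¹) * v * (𝒢.iotaR x)⁻¹

/-- The iterated right transport `v^{(i)}_R` of `v` along the right cyclings of `x`. -/
noncomputable def transRIter (x : G) : ℕ → G → G
  | 0, v => v
  | i + 1, v => 𝒢.transR ((𝒢.cR)^[i] x) (transRIter x i v)

/-- Arrows of the left ultra summit graph `USG_L(x)`: triples `(u, s, v)` with
`u, v ∈ USS_L(x)`, `s` simple and `s⁻¹ u s = v`. -/
def ArrL (x : G) : Set (G × G × G) :=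
  {a | a.1 ∈ 𝒢.USSL x ∧ a.2.2 ∈ 𝒢.USSL x ∧ Simple 𝒢.pos 𝒢.Δ a.2.1 ∧
    a.2.1⁻¹ * a.1 * a.2.1 = a.2.2}

/-- Arrows of the right ultra summit graph `USG_R(x)`: triples `(u, s, v)` with
`u, v ∈ USS_R(x)`, `s` simple and `s u s⁻¹ = v`. -/
def ArrR (x : G) : Set (G × G × G) :=
  {a | a.1 ∈ 𝒢.USSR x ∧ a.2.2 ∈ 𝒢.USSR x ∧ Simple 𝒢.pos 𝒢.Δ a.2.1 ∧
    a.2.1 * a.1 * a.2.1⁻¹ = a.2.2}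

/-- `PathFrom A u l`: the list of arrows `l` forms a directed path in the
graph with arrow set `A`, starting at the vertex `u`. -/
def PathFrom (A : Set (G × G × G)) : G → List (G × G × G) → Prop
  | _, [] => True
  | u, a :: rest => a ∈ A ∧ a.1 = u ∧ PathFrom A a.2.2 rest

/-- Minimal arrows of `USG_L(x)`: arrows whose label is not a product of the
labels of a directed path of length at least 2 starting at the same vertex. -/
def MinArrL (x : G) : Set (G × G × G) :=
  {a | a ∈ 𝒢.ArrL x ∧ ¬ ∃ l : List (G × G × G), 2 ≤ l.length ∧
    PathFrom (𝒢.ArrL x) a.1 l ∧ (l.map (fun b => b.2.1)).prod = a.2.1}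

/-- Minimal arrows of `USG_R(x)`. -/
def MinArrR (x : G) : Set (G × G × G) :=
  {a | a ∈ 𝒢.ArrR x ∧ ¬ ∃ l : List (G × G × G), 2 ≤ l.length ∧
    PathFrom (𝒢.ArrR x) a.1 l ∧ (l.map (fun b => b.2.1)).prod = a.2.1}

end GarsideGroup

end Garside

namespace Garside

/-- The braid relations on `m` generators `σ₀, …, σ_{m-1}`:
`σᵢσⱼ = σⱼσᵢ` for `|i-j| > 1` and `σᵢσⱼσᵢ = σⱼσᵢσⱼ` for `|i-j| = 1`. -/
def braidRels (m : ℕ) : Set (FreeGroup (Fin m)) :=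
  {r | (∃ i j : Fin m, (i : ℕ) + 1 < (j : ℕ) ∧
          r = FreeGroup.of i * FreeGroup.of j * (FreeGroup.of i)⁻¹ * (FreeGroup.of j)⁻¹) ∨
       (∃ i j : Fin m, (i : ℕ) + 1 = (j : ℕ) ∧
          r = FreeGroup.of i * FreeGroup.of j * FreeGroup.of i *
              (FreeGroup.of j * FreeGroup.of i * FreeGroup.of j)⁻¹)}

/-- Artin's braid group on `n` strands, presented by the `n-1` generators
`σ₁, …, σ_{n-1}` and the braid relations. -/
abbrev BraidGroup (n : ℕ) := PresentedGroup (braidRels (n - 1))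

/-- The Artin generators of the braid group. -/
def σB (n : ℕ) (i : Fin (n - 1)) : BraidGroup n :=
  PresentedGroup.of (rels := braidRels (n - 1)) i

/-- The half twist `Δ = σ₁ (σ₂σ₁) ⋯ (σ_{n-1} ⋯ σ₁)`, the Garside element of `Bₙ`. -/
def halfTwist (n : ℕ) : BraidGroup n :=
  ((List.finRange (n - 1)).map fun k =>
    ((((List.finRange (n - 1)).filter fun j => decide (j ≤ k)).reverse.map (σB n)).prod)).prod

/-- `𝒢` is the (left and right) Garside structure of the braid group `Bₙ`:
the positive cone is the monoid of positive braids, generated by the Artin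
generators, and the Garside element is the half twist `Δ`. -/
def IsBraidGarside (n : ℕ) (𝒢 : GarsideGroup (BraidGroup n)) : Prop :=
  𝒢.pos = Submonoid.closure (Set.range (σB n)) ∧ 𝒢.Δ = halfTwist n

end Garside

namespace Garside

/-- Lattice-theoretic core of a Garside structure. -/
structure LG (G : Type*) [Group G] where
  P : Submonoid G
  anti : ∀ a : G, a ∈ P → a⁻¹ ∈ P → a = 1
  Δ : G
  Δ_mem : Δ ∈ P
  conj₁ : ∀ x ∈ P, Δ * x * Δ⁻¹ ∈ P
  conj₂ : ∀ x ∈ P, Δ⁻¹ * x * Δ ∈ P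
  gL : G → G → G
  gL₁ : ∀ a b, (gL a b)⁻¹ * a ∈ P
  gL₂ : ∀ a b, (gL a b)⁻¹ * b ∈ P
  gL₃ : ∀ a b c, c⁻¹ * a ∈ P → c⁻¹ * b ∈ P → c⁻¹ * gL a b ∈ P
  gR : G → G → G
  gR₁ : ∀ a b, a * (gR a b)⁻¹ ∈ P
  gR₂ : ∀ a b, b * (gR a b)⁻¹ ∈ P
  gR₃ : ∀ a b c, a * c⁻¹ ∈ P → b * c⁻¹ ∈ P → gR a b * c⁻¹ ∈ P
  bound : ∀ g : G, ∃ k : ℕ, Δ ^ k * g ∈ P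
  central : ∃ e : ℕ, 1 ≤ e ∧ ∀ g : G, Commute (Δ ^ e) g
  fin : ∀ c : ℕ, {x : G | x ∈ P ∧ x⁻¹ * Δ ^ c ∈ P}.Finite

namespace LG

variable {G : Type*} [Group G] (L : LG G)

/-- The opposite structure. -/
def op : LG Gᵐᵒᵖ where
  P := L.P.op
  anti a h h' := by
    have := L.anti a.unop h (by simpa using h')
    exact MulOpposite.unop_injective (by simpa using this)
  Δ := MulOpposite.op L.Δ
  Δ_mem := L.Δ_mem
  conj₁ x hx := by
    have := L.conj₂ _ hx
    simpa [Submonoid.mem_op, mul_assoc] using this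
  conj₂ x hx := by
    have := L.conj₁ _ hx
    simpa [Submonoid.mem_op, mul_assoc] using this
  gL a b := MulOpposite.op (L.gR a.unop b.unop)
  gL₁ a b := by simpa [Submonoid.mem_op] using L.gR₁ a.unop b.unop
  gL₂ a b := by simpa [Submonoid.mem_op] using L.gR₂ a.unop b.unop
  gL₃ a b c h h' := by
    simpa [Submonoid.mem_op] using L.gR₃ a.unop b.unop c.unop h h'
  gR a b := MulOpposite.op (L.gL a.unop b.unop)
  gR₁ a b := by simpa [Submonoid.mem_op] using L.gL₁ a.unop b.unop
  gR₂ a b := by simpa [Submonoid.mem_op] using L.gL₂ a.unop b.unop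
  gR₃ a b c h h' := by
    simpa [Submonoid.mem_op] using L.gL₃ a.unop b.unop c.unop h h'
  bound g := by
    obtain ⟨k, hk⟩ := L.bound g.unop
    refine ⟨k, ?_⟩
    have : ∀ k : ℕ, ∀ x ∈ L.P, L.Δ⁻¹ ^ k * x * L.Δ ^ k ∈ L.P := by
      intro k
      induction k with
      | zero => intro x hx; simpa using hx
      | succ k ih =>
        intro x hx
        have := ih _ (L.conj₂ x hx)
        convert this using 1
        group
    have := this k _ hk
    show (MulOpposite.op L.Δ ^ k * g).unop ∈ L.P
    convert this using 1
    simp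
  central := by
    obtain ⟨e, h1, h⟩ := L.central
    refine ⟨e, h1, fun g => ?_⟩
    have := (h g.unop).symm
    apply MulOpposite.unop_injective
    simpa using this.eq
  fin c := by
    have h : ∀ k : ℕ, ∀ x ∈ L.P, L.Δ ^ k * x * L.Δ⁻¹ ^ k ∈ L.P := by
      intro k
      induction k with
      | zero => intro x hx; simpa using hx
      | succ k ih =>
        intro x hx
        have := ih _ (L.conj₁ x hx)
        convert this using 1
        group
    have h' : ∀ k : ℕ, ∀ x ∈ L.P, L.Δ⁻¹ ^ k * x * L.Δ ^ k ∈ L.P := by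
      intro k
      induction k with
      | zero => intro x hx; simpa using hx
      | succ k ih =>
        intro x hx
        have := ih _ (L.conj₂ x hx)
        convert this using 1
        group
    refine ((L.fin c).image MulOpposite.op).subset ?_
    rintro x ⟨hx, hx'⟩
    refine ⟨x.unop, ⟨hx, ?_⟩, rfl⟩
    have h2 : L.Δ ^ c * x.unop⁻¹ ∈ L.P := by simpa [Submonoid.mem_op] using hx'
    have := h' c _ h2
    convert this using 1
    group

variable {L}

theorem cj (k : ℤ) {x : G} (hx : x ∈ L.P) : L.Δ ^ k * x * L.Δ ^ (-k) ∈ L.P := by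
  induction k with
  | zero => simpa using hx
  | succ k ih =>
    convert L.conj₁ _ ih using 1
    group
  | pred k ih =>
    convert L.conj₂ _ ih using 1
    group

theorem cj_iff (k : ℤ) {x : G} : L.Δ ^ k * x * L.Δ ^ (-k) ∈ L.P ↔ x ∈ L.P := by
  refine ⟨fun h => ?_, cj k⟩
  convert cj (-k) h using 1
  group

/-- Cyclic permutation around a power of `Δ`. -/
theorem rot {k : ℤ} {x y : G} (h : x * y ∈ L.P) (hy : y = L.Δ ^ k) : y * x ∈ L.P := by
  subst hy
  convert cj k h using 1
  group

theorem rotL (k : ℤ) {x : G} : x * L.Δ ^ k ∈ L.P ↔ L.Δ ^ k * x ∈ L.P :=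
  ⟨fun h => rot h rfl, fun h => by convert cj (-k) h using 1; group⟩

theorem pow_mem {k : ℤ} (hk : 0 ≤ k) : L.Δ ^ k ∈ L.P := by
  obtain ⟨n, rfl⟩ := Int.eq_ofNat_of_zero_le hk
  simpa using L.P.pow_mem L.Δ_mem n

theorem mulΔ {k : ℤ} (hk : 0 ≤ k) {x : G} (hx : x ∈ L.P) : L.Δ ^ k * x ∈ L.P :=
  L.P.mul_mem (pow_mem hk) hx

/-- Lemma K. -/
theorem lemK {a y : G} {k : ℤ} (hk : 0 ≤ k) (h : a⁻¹ * (y * L.Δ ^ k) ∈ L.P) :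
    ((L.gL a y)⁻¹ * a)⁻¹ * L.Δ ^ k ∈ L.P := by
  have h1 : L.Δ ^ k * a⁻¹ * y ∈ L.P := by
    have : (a⁻¹ * y) * L.Δ ^ k ∈ L.P := by convert h using 1; group
    have := (rotL k).1 this
    convert this using 1; group
  have h2 : (a * L.Δ ^ (-k))⁻¹ * a ∈ L.P := by
    convert pow_mem (L := L) hk using 1; group
  have h3 : (a * L.Δ ^ (-k))⁻¹ * y ∈ L.P := by
    convert h1 using 1; group
  have h4 := L.gL₃ a y _ h2 h3
  have h5 : L.Δ ^ k * (a⁻¹ * L.gL a y) ∈ L.P := by convert h4 using 1; group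
  convert (rotL k).2 h5 using 1
  group

theorem triv_of_gcd {f : G} (hf : f ∈ L.P) (h : L.gL f L.Δ = 1) : f = 1 := by
  obtain ⟨k, hk⟩ := L.bound f⁻¹
  have h0 : ∀ k : ℕ, f⁻¹ * L.Δ ^ (k : ℤ) ∈ L.P → f = 1 := by
    intro k
    induction k with
    | zero => intro h'; exact L.anti f hf (by simpa using h')
    | succ k ih =>
      intro h'
      apply ih
      have := lemK (L := L) (a := f) (y := L.Δ) (k := k) (by positivity)
        (by convert h' using 1; push_cast; group)
      rw [h] at this
      simpa using this
  exact h0 k ((rotL _).2 (by simpa using hk))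

/-! ### Iterated cyclings -/

variable (L)

/-- initial factor, relative to the exponent `p` -/
def iL (p : ℤ) (y : G) : G := L.gL L.Δ (y * L.Δ ^ (-p))
/-- right initial factor, relative to the exponent `p` -/
def iR (p : ℤ) (y : G) : G := L.gR L.Δ (L.Δ ^ (-p) * y)
/-- left cycling -/
def cyL (p : ℤ) (y : G) : G := (L.iL p y)⁻¹ * y * L.iL p y
/-- right cycling -/
def cyR (p : ℤ) (y : G) : G := L.iR p y * y * (L.iR p y)⁻¹
/-- conjugating element of iterated left cycling -/
def CL (p : ℤ) : ℕ → G → G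
  | 0, _ => 1
  | N + 1, y => CL p N y * L.iL p ((L.cyL p)^[N] y)
/-- conjugating element of iterated right cycling -/
def CR (p : ℤ) : ℕ → G → G
  | 0, _ => 1
  | N + 1, y => L.iR p ((L.cyR p)^[N] y) * CR p N y

theorem op_iL (p : ℤ) (y : G) : L.op.iL p (MulOpposite.op y) = MulOpposite.op (L.iR p y) := by
  simp [iL, iR, op]
theorem op_iR (p : ℤ) (y : G) : L.op.iR p (MulOpposite.op y) = MulOpposite.op (L.iL p y) := by
  simp [iL, iR, op]
theorem op_cyL (p : ℤ) (y : G) : L.op.cyL p (MulOpposite.op y) = MulOpposite.op (L.cyR p y) := by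
  simp [cyL, cyR, op_iL, mul_assoc]
theorem op_cyR (p : ℤ) (y : G) : L.op.cyR p (MulOpposite.op y) = MulOpposite.op (L.cyL p y) := by
  simp [cyL, cyR, op_iR, mul_assoc]
theorem op_cyL_it (p : ℤ) (N : ℕ) (y : G) :
    (L.op.cyL p)^[N] (MulOpposite.op y) = MulOpposite.op ((L.cyR p)^[N] y) := by
  induction N generalizing y with
  | zero => rfl
  | succ N ih => rw [Function.iterate_succ_apply, Function.iterate_succ_apply, op_cyL, ih]
theorem op_cyR_it (p : ℤ) (N : ℕ) (y : G) :
    (L.op.cyR p)^[N] (MulOpposite.op y) = MulOpposite.op ((L.cyL p)^[N] y) := by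
  induction N generalizing y with
  | zero => rfl
  | succ N ih => rw [Function.iterate_succ_apply, Function.iterate_succ_apply, op_cyR, ih]
theorem op_CL (p : ℤ) (N : ℕ) (y : G) :
    L.op.CL p N (MulOpposite.op y) = MulOpposite.op (L.CR p N y) := by
  induction N with
  | zero => rfl
  | succ N ih => simp [CL, CR, ih, op_cyL_it, op_iL]
theorem op_CR (p : ℤ) (N : ℕ) (y : G) :
    L.op.CR p N (MulOpposite.op y) = MulOpposite.op (L.CL p N y) := by
  induction N with
  | zero => rfl
  | succ N ih => simp [CL, CR, ih, op_cyR_it, op_iR]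

theorem cyL_it (p : ℤ) (N : ℕ) (y : G) :
    (L.cyL p)^[N] y = (L.CL p N y)⁻¹ * y * L.CL p N y := by
  induction N with
  | zero => simp [CL]
  | succ N ih =>
    rw [Function.iterate_succ_apply', CL]
    conv_lhs => rw [cyL]
    rw [ih]; group

theorem cyR_it (p : ℤ) (N : ℕ) (y : G) :
    (L.cyR p)^[N] y = (L.CR p N y) * y * (L.CR p N y)⁻¹ := by
  induction N with
  | zero => simp [CR]
  | succ N ih =>
    rw [Function.iterate_succ_apply', CR]
    conv_lhs => rw [cyR]
    rw [ih]; group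

theorem CR_add (p : ℤ) (M N : ℕ) (y : G) :
    L.CR p (M + N) y = L.CR p M ((L.cyR p)^[N] y) * L.CR p N y := by
  induction M with
  | zero => simp [CR]
  | succ M ih =>
    rw [Nat.succ_add, CR, ih, CR, Function.iterate_add_apply, mul_assoc]

theorem iL_char (p : ℤ) (y c : G) : c⁻¹ * L.iL p y ∈ L.P ↔
    c⁻¹ * L.Δ ∈ L.P ∧ c⁻¹ * (y * L.Δ ^ (-p)) ∈ L.P := by
  constructor
  · intro h
    constructor
    · convert L.P.mul_mem h (L.gL₁ L.Δ (y * L.Δ ^ (-p))) using 1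
      rw [iL]; group
    · convert L.P.mul_mem h (L.gL₂ L.Δ (y * L.Δ ^ (-p))) using 1
      rw [iL]; group
  · rintro ⟨h1, h2⟩
    exact L.gL₃ _ _ _ h1 h2

theorem CL_char (p : ℤ) (N : ℕ) (y c : G) : c⁻¹ * L.CL p N y ∈ L.P ↔
    ∀ j : ℕ, j ≤ N → c⁻¹ * (y ^ j * L.Δ ^ ((N : ℤ) - j - j * p)) ∈ L.P := by
  induction N generalizing c with
  | zero =>
    simp [CL]
  | succ N ih =>
    have e1 : c⁻¹ * L.CL p (N + 1) y ∈ L.P ↔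
        (c * L.Δ ^ (-1 : ℤ))⁻¹ * L.CL p N y ∈ L.P ∧
        (y⁻¹ * c * L.Δ ^ p)⁻¹ * L.CL p N y ∈ L.P := by
      rw [CL, show c⁻¹ * (L.CL p N y * L.iL p ((L.cyL p)^[N] y)) =
        ((L.CL p N y)⁻¹ * c)⁻¹ * L.iL p ((L.cyL p)^[N] y) by group, iL_char, cyL_it]
      refine and_congr ?_ ?_
      · rw [← cj_iff (L := L) 1]
        refine iff_of_eq (congrArg (· ∈ L.P) ?_)
        group
      · rw [← cj_iff (L := L) (-p)]
        refine iff_of_eq (congrArg (· ∈ L.P) ?_)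
        group
    rw [e1, ih, ih]
    constructor
    · rintro ⟨h1, h2⟩ j hj
      rcases Nat.eq_zero_or_pos j with rfl | hj0
      · have := h1 0 (Nat.zero_le _)
        rw [← cj_iff (L := L) 1] at *
        convert cj (-1) this using 1
        push_cast; group
      · obtain ⟨i, rfl⟩ : ∃ i, j = i + 1 := ⟨j - 1, by omega⟩
        have := cj p (h2 i (by omega))
        convert this using 1
        push_cast; rw [pow_succ']; group
    · intro h
      constructor
      · intro j hj
        have := cj 1 (h j (by omega))
        convert this using 1
        push_cast; group
      · intro j hj
        have := cj (-p) (h (j + 1) (by omega))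
        convert this using 1
        push_cast; rw [pow_succ']; group

theorem CR_char (p : ℤ) (N : ℕ) (y c : G) : L.CR p N y * c⁻¹ ∈ L.P ↔
    ∀ j : ℕ, j ≤ N → L.Δ ^ ((N : ℤ) - j - j * p) * y ^ j * c⁻¹ ∈ L.P := by
  have := L.op.CL_char p N (MulOpposite.op y) (MulOpposite.op c)
  rw [op_CL] at this
  simpa [op, Submonoid.mem_op] using this

end LG
end Garside
namespace Garside
namespace LG

variable {G : Type*} [Group G] {L : LG G}

theorem tot {a b : ℤ} {X : G} (hX : X ∈ L.P) (h : 0 ≤ a + b) : L.Δ ^ a * X * L.Δ ^ b ∈ L.P := by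
  convert mulΔ h (cj (-b) hX) using 1
  group

theorem powlow {p : ℤ} {u : G} (h : u * L.Δ ^ (-p) ∈ L.P) (j : ℕ) :
    u ^ j * L.Δ ^ (-(j * p)) ∈ L.P := by
  induction j with
  | zero => simpa using L.P.one_mem
  | succ j ih =>
    convert L.P.mul_mem h (cj p ih) using 1
    rw [pow_succ']; push_cast; group

variable (L) in
/-- `y` has infimum at least `p` and supremum at most `p + r`. -/
structure Bd (p : ℤ) (r : ℕ) (y : G) : Prop where
  lo : y * L.Δ ^ (-p) ∈ L.P
  hi : y⁻¹ * L.Δ ^ (p + r) ∈ L.P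

theorem Bd.powlo {p : ℤ} {r : ℕ} {u : G} (h : L.Bd p r u) (j : ℕ) :
    u ^ j * L.Δ ^ (-(j * p)) ∈ L.P := powlow h.lo j

theorem Bd.powhi {p : ℤ} {r : ℕ} {u : G} (h : L.Bd p r u) (j : ℕ) :
    (u ^ j)⁻¹ * L.Δ ^ (j * (p + r)) ∈ L.P := by
  have := powlow (L := L) (p := -(p + r)) (u := u⁻¹) (by simpa using h.hi) j
  convert this using 1
  rw [inv_pow]; congr 2; ring

variable (L) in
/-- lattice form of left rigidity -/
structure Rig (p : ℤ) (r : ℕ) (u : G) : Prop extends L.Bd p r u where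
  pos : 1 ≤ r
  star : ∀ x, x⁻¹ * L.Δ ^ (p + r) ∈ L.P → x⁻¹ * (u * L.iL p u) ∈ L.P → x⁻¹ * u ∈ L.P

theorem Rig.factB {p : ℤ} {r : ℕ} {u : G} (h : L.Rig p r u) (n : ℕ) :
    ∀ x, x⁻¹ * L.Δ ^ (p + r) ∈ L.P → x⁻¹ * (u ^ (n + 1) * L.Δ ^ (-(n * p))) ∈ L.P →
      x⁻¹ * u ∈ L.P := by
  induction n with
  | zero => intro x _ h2; simpa using h2
  | succ n ih =>
    intro x hx1 hx2
    set z := u ^ (n + 1 + 1) * L.Δ ^ (-(((n + 1 : ℕ) : ℤ) * p)) with hz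
    set X := L.gL (L.Δ ^ (p + r)) z with hX
    have hX1 : X⁻¹ * L.Δ ^ (p + r) ∈ L.P := L.gL₁ _ _
    have hX2 : X⁻¹ * z ∈ L.P := L.gL₂ _ _
    have hxX : x⁻¹ * X ∈ L.P := L.gL₃ _ _ _ hx1 hx2
    have huX : u⁻¹ * X ∈ L.P := by
      refine L.gL₃ _ _ _ h.hi ?_
      convert h.powlo (n + 1) using 1
      rw [hz, pow_succ']; group
    set f := u⁻¹ * X with hf
    have hXf : X = u * f := by rw [hf]; group
    have key : L.gL f L.Δ = 1 := by
      set f1 := L.gL f L.Δ with hf1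
      have f1P : f1 ∈ L.P := by
        simpa using L.gL₃ f L.Δ 1 (by simpa using huX) (by simpa using L.Δ_mem)
      have a1 : f1⁻¹ * f ∈ L.P := L.gL₁ _ _
      have a2 : f1⁻¹ * L.Δ ∈ L.P := L.gL₂ _ _
      have a3 : f1⁻¹ * (u * L.Δ ^ (-p)) ∈ L.P := by
        have := ih (f1 * L.Δ ^ p) (by
          have := tot (L := L) (a := -p) (b := p + r - 1) a2 (by have := h.pos; omega)
          convert this using 1
          group) (by
          have a4 : f1⁻¹ * (u⁻¹ * z) ∈ L.P := by
            convert L.P.mul_mem a1 hX2 using 1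
            rw [hf]; group
          convert cj (-p) a4 using 1
          rw [hz, pow_succ' u (n + 1)]; push_cast; group)
        convert cj p this using 1
        group
      have a5 : f1⁻¹ * L.iL p u ∈ L.P := (L.iL_char p u f1).2 ⟨a2, a3⟩
      have a6 := h.star (u * f1) (by
        convert L.P.mul_mem a1 hX1 using 1
        rw [hXf]; group) (by convert a5 using 1; group)
      exact L.anti _ f1P (by convert a6 using 1; group)
    have hf1 : f = 1 := triv_of_gcd huX key
    rw [hXf, hf1, mul_one] at hxX
    exact hxX

theorem F3 {a z d : G} {k i : ℤ} (hi : 0 ≤ i)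
    (h : ∀ x, x⁻¹ * L.Δ ^ k ∈ L.P → x⁻¹ * z ∈ L.P → x⁻¹ * a ∈ L.P)
    (h1 : d⁻¹ * z ∈ L.P) (h2 : d⁻¹ * L.Δ ^ (k + i) ∈ L.P) :
    (a⁻¹ * d)⁻¹ * L.Δ ^ i ∈ L.P := by
  have k1 := lemK (L := L) (a := d) (y := L.Δ ^ k) hi (by rwa [← zpow_add])
  set g := L.gL d (L.Δ ^ k)
  have g1 : g⁻¹ * d ∈ L.P := L.gL₁ _ _
  have g2 : g⁻¹ * a ∈ L.P := h _ (L.gL₂ _ _) (by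
    convert L.P.mul_mem g1 h1 using 1; group)
  convert L.P.mul_mem k1 (cj (-i) g2) using 1
  group

theorem Rig.phi {p : ℤ} {r : ℕ} {u : G} (h : L.Rig p r u) (m M : ℕ) {i : ℤ} (hi : 0 ≤ i) {b : G}
    (h1 : b⁻¹ * (u ^ M * L.Δ ^ (-(M * p))) ∈ L.P)
    (h2 : (u ^ m * b)⁻¹ * L.Δ ^ (m * (p + r) + i) ∈ L.P) : b⁻¹ * L.Δ ^ i ∈ L.P := by
  induction m with
  | zero => simpa using h2
  | succ m ih =>
    apply ih
    have := F3 (L := L) (a := u) (z := u ^ (m + M + 1) * L.Δ ^ (-(((m + M : ℕ) : ℤ) * p)))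
      (d := u ^ (m + 1) * b * L.Δ ^ (-(m * p))) (k := p + r) (i := m * r + i) (by positivity)
      (h.factB (m + M)) (by
        convert cj (m * p) h1 using 1
        rw [show m + M + 1 = (m + 1) + M by omega, pow_add]; push_cast; group) (by
        convert cj (m * p) h2 using 1
        push_cast; group)
    convert cj (-(m * p)) this using 1
    rw [pow_succ']; group

theorem Bd.suf {p : ℤ} {r : ℕ} {u : G} (hr : 1 ≤ r) (h : L.Bd p r u) (m : ℕ) :
    L.CR p (r * m) u * (L.Δ ^ (-(m * p)) * u ^ m)⁻¹ ∈ L.P := by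
  rw [CR_char]
  intro j hj
  rcases le_total m j with hm | hm
  · obtain ⟨i, rfl⟩ := Nat.exists_eq_add_of_le hm
    have := tot (L := L) (a := ((r * m : ℕ) : ℤ) - (m + i : ℕ) - (m + i : ℕ) * p)
      (b := (m + i : ℕ) * p) (h.powlo i) (by push_cast at *; omega)
    convert this using 1
    rw [pow_add, (Commute.pow_pow_self u m i).eq]; push_cast; group
  · obtain ⟨i, rfl⟩ := Nat.exists_eq_add_of_le hm
    have := tot (L := L) (a := ((r * (j + i) : ℕ) : ℤ) - j - j * p)
      (b := (j + i) * p - i * (p + r)) (h.powhi i) (by push_cast; nlinarith)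
    convert this using 1
    rw [pow_add, (Commute.pow_pow_self u j i).eq]; push_cast; group

/-- Theorem I. -/
theorem Rig.CL_CR {p : ℤ} {r : ℕ} {u : G} (h : L.Rig p r u) (m : ℕ) :
    L.CL p (r * m) ((L.cyR p)^[r * m] u) = L.CR p (r * m) u := by
  set N := r * m with hN
  set w := (L.cyR p)^[N] u with hw
  set R := L.CR p N u with hR
  set D := L.CL p N w with hD
  have hwu : w = R * u * R⁻¹ := L.cyR_it p N u
  have hwj : ∀ j : ℕ, w ^ j = R * u ^ j * R⁻¹ := fun j => by rw [hwu, conj_pow]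
  have hRc := (L.CR_char p N u R).1 (by simpa [hR] using L.P.one_mem)
  have hR1 : R ∈ L.P := by
    have := (L.CR_char p N u 1).2 (fun j hj => by
      have := tot (L := L) (a := (N : ℤ) - j - j * p) (b := j * p) (h.powlo j) (by
        omega)
      convert this using 1
      group)
    simpa using this
  have hE : R⁻¹ * D ∈ L.P := by
    rw [hD, CL_char]
    intro j hj
    have := hRc j hj
    have : L.Δ ^ ((N : ℤ) - j - j * p) * (u ^ j * R⁻¹) ∈ L.P := by
      rwa [← mul_assoc]
    convert (rotL _).2 this using 1
    rw [hwj]; group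
  have hDc := (L.CL_char p N w D).1 (by simpa [hD] using L.P.one_mem)
  have hD0 : D⁻¹ * L.Δ ^ (N : ℤ) ∈ L.P := by simpa using hDc 0 (Nat.zero_le _)
  have hDN : D⁻¹ * (w ^ N * L.Δ ^ (-(N * p))) ∈ L.P := by
    convert hDc N le_rfl using 1
    group
  set E := R⁻¹ * D with hEd
  have hDE : D = R * E := by rw [hEd]; group
  have e1 : E⁻¹ * (u ^ N * L.Δ ^ (-(N * p))) ∈ L.P := by
    convert L.P.mul_mem hDN (cj (N * p) hR1) using 1
    rw [hwj, hDE]; group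
  have hQ := h.toBd.suf h.pos m
  rw [← hN, ← hR] at hQ
  have e2 : (u ^ m * E)⁻¹ * L.Δ ^ (m * (p + r) + 0) ∈ L.P := by
    convert (L.P.mul_mem hD0 (cj (-(N : ℤ)) hQ)) using 1
    rw [hDE, hN]; push_cast; group
  have e3 := h.phi m N le_rfl e1 e2
  have e4 : E = 1 := L.anti _ hE (by simpa using e3)
  rw [hDE, e4, mul_one]

end LG
end Garside
namespace Garside
namespace LG

variable {G : Type*} [Group G] {L : LG G}

theorem Rig.unif {p : ℤ} {r : ℕ} {u g w : G} (h : L.Rig p r u) (hw : w = g * u * g⁻¹) :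
    ∃ C : ℕ, ∀ (m n : ℕ) (t : G), t ∈ L.P → t⁻¹ * (w ^ n * L.Δ ^ (-(n * p))) ∈ L.P →
      (w ^ m * t)⁻¹ * L.Δ ^ (m * (p + r)) ∈ L.P → t⁻¹ * L.Δ ^ C ∈ L.P := by
  have wlog_g : ∃ g ∈ L.P, w = g * u * g⁻¹ := by
    obtain ⟨k, hk⟩ := L.bound g
    obtain ⟨e, he, hce⟩ := L.central
    refine ⟨L.Δ ^ (e * k) * g, ?_, ?_⟩
    · have := L.P.mul_mem (pow_mem (L := L) (k := (e : ℤ) * k - k) (by nlinarith)) hk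
      convert this using 1
      rw [← zpow_natCast, ← zpow_natCast L.Δ k]; push_cast; group
    · have hc : Commute (L.Δ ^ (e * k)) w := by rw [pow_mul]; exact (hce w).pow_left k
      rw [mul_inv_rev, show L.Δ ^ (e * k) * g * u * (g⁻¹ * (L.Δ ^ (e * k))⁻¹) =
        L.Δ ^ (e * k) * (g * u * g⁻¹) * (L.Δ ^ (e * k))⁻¹ by group, ← hw, hc.eq]
      group
  clear hw g
  obtain ⟨g, hg, hw⟩ := wlog_g
  obtain ⟨c, hc⟩ := L.bound g⁻¹
  have hh : g⁻¹ * L.Δ ^ (c : ℤ) ∈ L.P := (rotL _).2 (by simpa using hc)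
  refine ⟨5 * c, fun m n t ht h1 h2 => ?_⟩
  have hwj : ∀ j : ℕ, w ^ j = g * u ^ j * g⁻¹ := fun j => by rw [hw, conj_pow]
  rw [hwj] at h1 h2
  set a := g⁻¹ * t * g * L.Δ ^ (c : ℤ) with ha
  set y := u ^ n * L.Δ ^ (-(n * p)) with hy
  have aP : a ∈ L.P := by
    convert L.P.mul_mem hh (cj (-(c : ℤ)) (L.P.mul_mem ht hg)) using 1
    rw [ha]; group
  have a1 : a⁻¹ * (y * L.Δ ^ (2 * c : ℤ)) ∈ L.P := by
    convert L.P.mul_mem (cj (-(c : ℤ)) hh)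
      (cj (-(2 * c : ℤ)) (L.P.mul_mem h1 (cj (n * p) hg))) using 1
    rw [ha, hy]; group
  have k1 := lemK (L := L) (a := a) (y := y) (by positivity) a1
  set b := L.gL a y with hb
  have ba : b⁻¹ * a ∈ L.P := L.gL₁ _ _
  have k2 : b⁻¹ * L.Δ ^ (2 * c : ℤ) ∈ L.P := by
    refine h.phi m n (by positivity) (L.gL₂ _ _) ?_
    convert L.P.mul_mem ba (L.P.mul_mem (cj (-(c : ℤ)) hh)
      (cj (-(2 * c : ℤ)) (L.P.mul_mem h2 (cj (-(m * (p + r))) hg)))) using 1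
    rw [ha]; group
  convert L.P.mul_mem (L.P.mul_mem hg (pow_mem (k := c) (by positivity))) (L.P.mul_mem
    (L.P.mul_mem k1 (cj (-(2 * c : ℤ)) k2)) (cj (-(4 * c : ℤ)) hh)) using 1
  rw [ha, ← zpow_natCast]; push_cast; group

theorem CR_mul (p : ℤ) {N : ℕ} {w : G} (hN : (L.cyR p)^[N] w = w) (k : ℕ) :
    L.CR p (N * k) w = L.CR p N w ^ k := by
  have hk : ∀ k, (L.cyR p)^[N * k] w = w := fun k => by
    rw [Function.iterate_mul]; exact Function.iterate_fixed hN k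
  induction k with
  | zero => simp [CR]
  | succ k ih => rw [Nat.mul_succ, Nat.add_comm, CR_add, hk, ih, pow_succ']

/-- First half of Theorem II. -/
theorem Rig.CR_eq {p : ℤ} {r : ℕ} {u g w : G} (h : L.Rig p r u) (hw : w = g * u * g⁻¹)
    (hb : L.Bd p r w) {t : ℕ} (ht : 1 ≤ t) (hp : (L.cyR p)^[t] w = w) :
    ∃ N : ℕ, 1 ≤ N ∧ L.CR p (r * N) w = L.Δ ^ (-(N * p)) * w ^ N := by
  obtain ⟨e, he, hce⟩ := L.central
  obtain ⟨C, hC⟩ := h.unif hw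
  have hr := h.pos
  set N := t * e with hN
  have hN1 : 1 ≤ N := Nat.mul_pos ht he
  have hpN : (L.cyR p)^[N] w = w := by
    rw [Function.iterate_mul]; exact Function.iterate_fixed hp e
  set Q := L.CR p N w with hQ
  have hcent : ∀ (k : ℤ) (x : G), Commute (L.Δ ^ (N * k)) x := fun k x => by
    rw [show (N * k : ℤ) = (e : ℕ) * (t * k) by rw [hN]; push_cast; ring, zpow_mul, zpow_natCast]
    exact (hce x).zpow_left _
  have hQw : Commute Q w := by
    have h3 := L.cyR_it p N w
    rw [hpN] at h3
    have : w * Q = Q * w := by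
      rw [hQ]; nth_rewrite 1 [h3]; group
    exact this.symm
  refine ⟨N, hN1, ?_⟩
  have hQk : ∀ k : ℕ, L.CR p (N * (r * k)) w = Q ^ (r * k) := fun k => CR_mul p hpN _
  set T := Q ^ r * (w ^ N)⁻¹ * L.Δ ^ (N * p) with hT
  have T_eq : T = L.CR p (r * N) w * (L.Δ ^ (-(N * p)) * w ^ N)⁻¹ := by
    have := hQk 1
    rw [mul_one, mul_comm] at this
    rw [this, hT]; group
  have TP : T ∈ L.P := by rw [T_eq]; exact hb.suf hr N
  have Tk : ∀ k : ℕ, T ^ k = Q ^ (r * k) * (w ^ (N * k))⁻¹ * L.Δ ^ (N * (k * p)) := fun k => by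
    rw [hT, ((hcent p _).symm).mul_pow, ((hQw.pow_pow r N).inv_right).mul_pow, ← pow_mul,
      inv_pow, ← pow_mul, ← zpow_natCast (L.Δ ^ (N * p)), ← zpow_mul]
    congr 2; ring
  have hmem : ∀ k : ℕ, T ^ k ∈ {x : G | x ∈ L.P ∧ x⁻¹ * L.Δ ^ C ∈ L.P} := by
    intro k
    refine ⟨L.P.pow_mem TP k, ?_⟩
    have hch := (L.CR_char p (N * (r * k)) w (L.CR p (N * (r * k)) w)).1
      (by simp)
    rw [hQk] at hch
    have h0 := hch 0 (Nat.zero_le _)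
    have h1 := hch (N * (r * k)) le_rfl
    apply hC (N * k) (N * ((r - 1) * k)) _ (L.P.pow_mem TP k)
    · rw [Tk]
      have e1 : w ^ (N * (r * k)) = w ^ (N * ((r - 1) * k)) * w ^ (N * k) := by
        rw [← pow_add]; congr 1
        obtain ⟨s, rfl⟩ : ∃ s, r = s + 1 := ⟨r - 1, by omega⟩
        simp; ring
      have c1 : Commute (Q ^ (r * k))⁻¹ (w ^ (N * (r * k))) := (hQw.pow_pow _ _).inv_left
      rw [mul_assoc, ← c1.eq, e1] at h1
      have c2 := hcent (-(r * k * p)) ((Q ^ (r * k))⁻¹ * (w ^ (N * ((r - 1) * k)) * w ^ (N * k)))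
      have c3 : Commute (w ^ (N * ((r - 1) * k))) (w ^ (N * k)) := Commute.pow_pow_self _ _ _
      rw [show (((N * (r * k) : ℕ) : ℤ) - (N * (r * k) : ℕ) - (N * (r * k) : ℕ) * p) =
        N * (-(r * k * p)) by push_cast; ring, c2.eq, c3.eq] at h1
      have c4 := hcent (-(k * p)) ((Q ^ (r * k) * (w ^ (N * k))⁻¹)⁻¹ * w ^ (N * ((r - 1) * k)))
      have c5 : Commute (Q ^ (r * k))⁻¹ (w ^ (N * k)) := (hQw.pow_pow _ _).inv_left
      rw [← mul_assoc, c5.eq] at h1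
      convert h1 using 1
      rw [mul_inv_rev, ← zpow_neg, show -((N : ℤ) * (k * p)) = N * (-(k * p)) by ring,
        ← mul_assoc, mul_assoc (L.Δ ^ (N * -(k * p) : ℤ)), c4.eq]
      have : ((r - 1 : ℕ) : ℤ) = r - 1 := by push_cast [hr]; ring
      push_cast
      rw [show ((r : ℤ) * (k : ℤ) * p) = (r - 1) * k * p + k * p by ring]
      rw [this]
      group
    · rw [Tk]
      have c1 : Commute (Q ^ (r * k)) (w ^ (N * k)) := hQw.pow_pow _ _
      have c3 := hcent (-(k * p)) ((Q ^ (r * k))⁻¹)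
      have h0' : (Q ^ (r * k))⁻¹ * L.Δ ^ ((N * (r * k) : ℕ) : ℤ) ∈ L.P :=
        (rotL _).2 (by simpa using h0)
      convert h0' using 1
      rw [c1.inv_right.eq, ← mul_assoc, ← mul_assoc, mul_inv_cancel, one_mul, mul_inv_rev,
        ← zpow_neg, show -((N : ℤ) * (k * p)) = N * (-(k * p)) by ring, c3.eq]
      push_cast; group
  obtain ⟨a, b, hab, hTab⟩ := (L.fin C).exists_lt_map_eq_of_forall_mem hmem
  have hT1 : T = 1 := by
    obtain ⟨d, rfl⟩ := Nat.exists_eq_add_of_lt hab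
    rw [add_assoc, pow_add] at hTab
    have h1 : T ^ (d + 1) = 1 := by
      have : T ^ a * 1 = T ^ a * T ^ (d + 1) := by simpa using hTab
      exact (mul_left_cancel this).symm
    refine L.anti T TP ?_
    have : T⁻¹ = T ^ d := inv_eq_of_mul_eq_one_left (by rw [← pow_succ, h1])
    rw [this]; exact L.P.pow_mem TP d
  rw [T_eq] at hT1
  exact mul_inv_eq_one.1 hT1

end LG
end Garside
namespace Garside
namespace LG

variable {G : Type*} [Group G] {L : LG G}

theorem CR_r {p : ℤ} {r : ℕ} {w : G} (hr : 1 ≤ r) (hb : L.Bd p r w) {N : ℕ} (hN : 1 ≤ N)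
    (hE : L.CR p (r * N) w = L.Δ ^ (-(N * p)) * w ^ N) :
    L.Δ ^ (-p) * w * (L.CR p r w)⁻¹ ∈ L.P := by
  obtain ⟨M, rfl⟩ : ∃ M, N = M + 1 := ⟨N - 1, by omega⟩
  set Q := L.CR p r w with hQ
  have H := (L.CR_char p r w Q).1 (by simp [hQ])
  have key := (L.CR_char p (r * (M + 1)) w (L.Δ ^ (-(M * p)) * Q * w ^ M)).2 (fun j hj => by
    rcases le_or_gt M j with hM | hM
    · obtain ⟨i, rfl⟩ := Nat.exists_eq_add_of_le hM
      rcases le_or_gt i r with hi | hi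
      · have := tot (L := L) (a := r * M - M - M * p) (b := M * p) (H i hi) (by nlinarith)
        convert this using 1
        rw [pow_add, (Commute.pow_pow_self w M i).eq]; push_cast; group
      · obtain ⟨d, rfl⟩ := Nat.exists_eq_add_of_lt hi
        have := tot (L := L) (a := (r * (M + 1) : ℕ) - (M + (r + d + 1) : ℕ)
          - (M + (r + d + 1) : ℕ) * p) (b := (d + 1 + r) * p + M * p)
          (L.P.mul_mem (hb.powlo (d + 1)) (cj ((d + 1 + r) * p) (H r le_rfl)))
          (by push_cast at *; nlinarith)
        convert this using 1
        rw [show M + (r + d + 1) = (d + 1) + r + M by omega, pow_add _ (d + 1 + r), pow_add]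
        push_cast; group
    · obtain ⟨i, rfl⟩ := Nat.exists_eq_add_of_lt hM
      have := tot (L := L) (a := (r * (j + i + 1 + 1) : ℕ) - j
          - j * p) (b := -((i + 1) * (p + r) + r) + (j + i + 1) * p)
          (L.P.mul_mem (hb.powhi (i + 1)) (cj (-((i + 1) * (p + r) + r)) (H 0 (Nat.zero_le _))))
          (by push_cast; nlinarith)
      convert this using 1
      rw [add_assoc j, pow_add w j, (Commute.pow_pow_self w j _).eq]
      push_cast; group)
  rw [hE] at key
  convert cj (M * p) key using 1
  rw [pow_succ']; push_cast; group

variable (L) in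
/-- lattice form of right rigidity -/
structure RigR (p : ℤ) (r : ℕ) (u : G) : Prop extends L.Bd p r u where
  pos : 1 ≤ r
  star : ∀ x, L.Δ ^ (p + r) * x⁻¹ ∈ L.P → (L.iR p u * u) * x⁻¹ ∈ L.P → u * x⁻¹ ∈ L.P

/-- Theorem II. -/
theorem Rig.rigR {p : ℤ} {r : ℕ} {u g w : G} (h : L.Rig p r u) (hw : w = g * u * g⁻¹)
    (hr : 2 ≤ r)
    (hb : L.Bd p r w) {t : ℕ} (ht : 1 ≤ t) (hp : (L.cyR p)^[t] w = w) : L.RigR p r w := by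
  obtain ⟨N, hN, hE⟩ := h.CR_eq hw hb ht hp
  have hQ := CR_r h.pos hb hN hE
  refine ⟨hb, h.pos, fun x h1 h2 => ?_⟩
  have i1 : L.Δ * (L.iR p w)⁻¹ ∈ L.P := L.gR₁ _ _
  have i2 : L.Δ ^ (-p) * w * (L.iR p w)⁻¹ ∈ L.P := L.gR₂ _ _
  have := (L.CR_char p r w (L.Δ ^ (-p) * x)).2 (fun j hj => by
    rcases j with _ | _ | j
    · have := tot (L := L) (a := -p) (b := p) h1 (by omega)
      convert this using 1
      push_cast; group
    · have := tot (L := L) (a := r - 2 - p) (b := p) (L.P.mul_mem i1 h2) (by omega)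
      convert this using 1
      push_cast; group
    · have := tot (L := L) (a := r - (j + 2) - (j + 2) * p) (b := (j + 1) * p + p)
        (L.P.mul_mem (hb.powlo j) (cj ((j + 1) * p) (L.P.mul_mem i2 h2)))
        (by push_cast at *; nlinarith)
      convert this using 1
      rw [pow_succ, pow_succ]
      push_cast; group)
  convert cj p (L.P.mul_mem hQ this) using 1
  group

theorem op_Δ : L.op.Δ = MulOpposite.op L.Δ := rfl
theorem op_mem {x : G} : MulOpposite.op x ∈ L.op.P ↔ x ∈ L.P := Iff.rfl

theorem op_Bd {p : ℤ} {r : ℕ} {u : G} : L.op.Bd p r (MulOpposite.op u) ↔ L.Bd p r u := by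
  have e1 : L.op.Bd p r (MulOpposite.op u) ↔
    L.Δ ^ (-p) * u ∈ L.P ∧ L.Δ ^ (p + r) * u⁻¹ ∈ L.P := ⟨fun h => ⟨h.lo, h.hi⟩, fun h => ⟨h.1, h.2⟩⟩
  rw [e1, ← rotL, ← rotL]
  exact ⟨fun h => ⟨h.1, h.2⟩, fun h => ⟨h.lo, h.hi⟩⟩

theorem op_Rig {p : ℤ} {r : ℕ} {u : G} : L.op.Rig p r (MulOpposite.op u) ↔ L.RigR p r u := by
  constructor
  · intro h
    refine ⟨op_Bd.1 h.toBd, h.pos, fun x h1 h2 => ?_⟩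
    refine op_mem.1 (h.star (MulOpposite.op x) h1 ?_)
    rw [op_iL]; exact h2
  · intro h
    refine ⟨op_Bd.2 h.toBd, h.pos, fun x h1 h2 => ?_⟩
    rw [op_iL] at h2
    exact (h.star x.unop h1 h2)

theorem op_RigR {p : ℤ} {r : ℕ} {u : G} : L.op.RigR p r (MulOpposite.op u) ↔ L.Rig p r u := by
  constructor
  · intro h
    refine ⟨op_Bd.1 h.toBd, h.pos, fun x h1 h2 => ?_⟩
    refine op_mem.1 (h.star (MulOpposite.op x) h1 ?_)
    rw [op_iR]; exact h2
  · intro h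
    refine ⟨op_Bd.2 h.toBd, h.pos, fun x h1 h2 => ?_⟩
    rw [op_iR] at h2
    exact (h.star x.unop h1 h2)

theorem RigR.rig {p : ℤ} {r : ℕ} {u g w : G} (h : L.RigR p r u) (hw : w = g * u * g⁻¹)
    (hr : 2 ≤ r)
    (hb : L.Bd p r w) {t : ℕ} (ht : 1 ≤ t) (hp : (L.cyL p)^[t] w = w) : L.Rig p r w := by
  refine op_RigR.1 (Rig.rigR (g := MulOpposite.op g⁻¹) (op_Rig.2 h) ?_ hr (op_Bd.2 hb) ht ?_)
  · apply MulOpposite.unop_injective; simp [hw, mul_assoc]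
  · rw [op_cyR_it, hp]

theorem RigR.CR_CL {p : ℤ} {r : ℕ} {u : G} (h : L.RigR p r u) (m : ℕ) :
    L.CR p (r * m) ((L.cyL p)^[r * m] u) = L.CL p (r * m) u := by
  have := (op_Rig.2 h).CL_CR m
  rw [op_cyR_it, op_CL, op_CR] at this
  exact MulOpposite.op_injective this

/-! ### Cyclings preserve bounds -/

theorem Bd.cyL {p : ℤ} {r : ℕ} {y : G} (h : L.Bd p r y) (hr : 1 ≤ r) : L.Bd p r (L.cyL p y) := by
  set i := L.iL p y with hi
  have i1 : i⁻¹ * L.Δ ∈ L.P := L.gL₁ _ _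
  have i2 : i⁻¹ * (y * L.Δ ^ (-p)) ∈ L.P := L.gL₂ _ _
  have i3 : i ∈ L.P := by
    have := (L.iL_char p y 1).2 ⟨by simpa using L.Δ_mem, by simpa using h.lo⟩
    simpa using this
  refine ⟨?_, ?_⟩
  · rw [LG.cyL, ← hi]
    convert L.P.mul_mem i2 (cj p i3) using 1
    group
  · rw [LG.cyL, ← hi]
    have k : y⁻¹ * i * L.Δ ^ (p + r - 1) ∈ L.P := by
      have : (y * L.Δ ^ (-(p + r - 1)))⁻¹ * i ∈ L.P := (L.iL_char p y _).2 ⟨by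
        have := cj (p + r - 1) h.hi
        convert this using 1
        group, by
        have := pow_mem (L := L) (k := r - 1) (by omega)
        convert this using 1
        group⟩
      convert cj (-(p + r - 1)) this using 1
      group
    convert L.P.mul_mem i1 (cj (-1) k) using 1
    group

theorem Bd.cyR {p : ℤ} {r : ℕ} {y : G} (h : L.Bd p r y) (hr : 1 ≤ r) : L.Bd p r (L.cyR p y) := by
  have := Bd.cyL (op_Bd.2 h) hr
  rw [op_cyL] at this
  exact op_Bd.1 this

theorem Bd_finite (p : ℤ) (r : ℕ) : {y : G | L.Bd p r y}.Finite := by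
  have := (L.fin r).image (· * L.Δ ^ p)
  refine this.subset ?_
  intro y hy
  refine ⟨y * L.Δ ^ (-p), ⟨hy.lo, ?_⟩, by simp⟩
  have := cj p hy.hi
  convert this using 1
  rw [← zpow_natCast]; group

/-! ### Transport -/

theorem transR_pos {p : ℤ} (N : ℕ) {u v s : G} (hs : s ∈ L.P) (h : u * s = s * v) :
    L.CR p N u * s * (L.CR p N v)⁻¹ ∈ L.P := by
  have H := (L.CR_char p N v (L.CR p N v)).1 (by simp)
  have := (L.CR_char p N u (L.CR p N v * s⁻¹)).2 (fun j hj => by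
    have hj' : u ^ j * s = s * v ^ j := (SemiconjBy.pow_right (show SemiconjBy s v u from h.symm) j).symm
    convert L.P.mul_mem (cj ((N : ℤ) - j - j * p) hs) (H j hj) using 1
    rw [mul_inv_rev, inv_inv, ← mul_assoc, mul_assoc _ (u ^ j), hj']; group)
  convert this using 1
  group

theorem CR_conj {p : ℤ} (N : ℕ) (u : G) :
    L.CR p N (L.Δ⁻¹ * u * L.Δ) = L.Δ⁻¹ * L.CR p N u * L.Δ := by
  have H := (L.CR_char p N (L.Δ⁻¹ * u * L.Δ) (L.CR p N (L.Δ⁻¹ * u * L.Δ))).1 (by simp)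
  have H' := (L.CR_char p N u (L.CR p N u)).1 (by simp)
  have hj : ∀ j : ℕ, (L.Δ⁻¹ * u * L.Δ) ^ j = L.Δ⁻¹ * u ^ j * L.Δ := fun j => by
    simpa using conj_pow (i := j) (a := L.Δ⁻¹) (b := u)
  have a := (L.CR_char p N (L.Δ⁻¹ * u * L.Δ) (L.Δ⁻¹ * L.CR p N u * L.Δ)).2 (fun j hjN => by
    rw [hj]; convert cj (-1) (H' j hjN) using 1; group)
  have b := (L.CR_char p N u (L.Δ * L.CR p N (L.Δ⁻¹ * u * L.Δ) * L.Δ⁻¹)).2 (fun j hjN => by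
    have := H j hjN
    rw [hj] at this; convert cj 1 this using 1; group)
  have := L.anti _ a (by convert cj (-1) b using 1; group)
  exact mul_inv_eq_one.1 this

theorem transR_simple {p : ℤ} (N : ℕ) {u v s : G} (hs : s ∈ L.P) (hs' : s⁻¹ * L.Δ ∈ L.P)
    (h : u * s = s * v) :
    (L.CR p N u * s * (L.CR p N v)⁻¹)⁻¹ * L.Δ ∈ L.P := by
  have := transR_pos (p := p) N (u := v) (v := L.Δ⁻¹ * u * L.Δ) hs' (by
    have : v = s⁻¹ * (u * s) := by rw [h]; group
    rw [this]; group)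
  rw [CR_conj] at this
  convert this using 1
  group

theorem transL_simple {p : ℤ} (N : ℕ) {u v s : G} (hs : s ∈ L.P) (hs' : s⁻¹ * L.Δ ∈ L.P)
    (h : u * s = s * v) :
    (L.CL p N u)⁻¹ * s * (L.CL p N v) ∈ L.P ∧
    ((L.CL p N u)⁻¹ * s * (L.CL p N v))⁻¹ * L.Δ ∈ L.P := by
  have h' : MulOpposite.op v * MulOpposite.op s = MulOpposite.op s * MulOpposite.op u := by
    rw [← MulOpposite.op_mul, ← MulOpposite.op_mul, h]
  have hs2 : L.Δ * s⁻¹ ∈ L.P := by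
    have := cj 1 hs'
    convert this using 1; group
  have a := transR_pos (L := L.op) (p := p) N (op_mem.2 hs) h'
  have b := transR_simple (L := L.op) (p := p) N (op_mem.2 hs) hs2 h'
  rw [op_CR, op_CR] at a b
  have a' : (L.CL p N u)⁻¹ * (s * (L.CL p N v)) ∈ L.P := a
  have b' : L.Δ * ((L.CL p N u)⁻¹ * (s * (L.CL p N v)))⁻¹ ∈ L.P := b
  rw [mul_assoc]
  refine ⟨a', ?_⟩
  convert cj (-1) b' using 1
  group

/-! ### Extremality -/

theorem Rig.inf_max {p : ℤ} {r : ℕ} {u g y : G} (h : L.Rig p r u)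
    (hp : ¬ L.Δ ^ (-(p + 1)) * u ∈ L.P) (hw : u = g * y * g⁻¹) {q : ℤ}
    (hq : L.Δ ^ (-q) * y ∈ L.P) : q ≤ p := by
  by_contra hlt
  push Not at hlt
  obtain ⟨c, hc⟩ := L.bound g⁻¹
  obtain ⟨d, hd⟩ := L.bound g
  apply hp
  have hq' : y * L.Δ ^ (-(p + 1)) ∈ L.P := by
    have := tot (L := L) (a := 0) (b := q - p - 1) ((rotL _).2 hq) (by omega)
    convert this using 1; group
  set k := c + d + 1 with hk
  have hyk := powlow hq' k
  have huk : u ^ k * L.Δ ^ (-(k * (p + 1)) + c + d) ∈ L.P := by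
    rw [hw, conj_pow]
    have hc' := cj (k * (p + 1) - d) ((rotL (c : ℤ)).2 (by simpa using hc))
    convert L.P.mul_mem ((rotL (d : ℤ)).2 (by simpa using hd))
      (L.P.mul_mem (cj (-(d : ℤ)) hyk) hc') using 1
    group
  have := h.factB (c + d) (L.Δ ^ (p + 1)) (by
    convert pow_mem (L := L) (k := r - 1) (by have := h.pos; omega) using 1
    group) (by
    have := cj (-(p + 1)) huk
    convert this using 1
    rw [hk]; push_cast; group)
  convert this using 1; group

theorem Rig.sup_min {p : ℤ} {r : ℕ} {u g y : G} (h : L.Rig p r u)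
    (hp : ¬ u⁻¹ * L.Δ ^ (p + r - 1) ∈ L.P) (hw : u = g * y * g⁻¹) {q : ℤ}
    (hq : y⁻¹ * L.Δ ^ q ∈ L.P) : p + r ≤ q := by
  by_contra hlt
  push Not at hlt
  obtain ⟨c, hc⟩ := L.bound g⁻¹
  obtain ⟨d, hd⟩ := L.bound g
  apply hp
  have hq' : y⁻¹ * L.Δ ^ (-(-(p + r - 1))) ∈ L.P := by
    have := tot (L := L) (a := 0) (b := p + r - 1 - q) hq (by omega)
    convert this using 1; group
  set k := c + d + 1 with hk
  have hyk := powlow hq' k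
  have huk : (u ^ k)⁻¹ * L.Δ ^ (k * (p + r - 1) + c + d) ∈ L.P := by
    rw [hw, conj_pow]
    have hc' := cj (-(k * (p + r - 1) + d)) ((rotL (c : ℤ)).2 (by simpa using hc))
    convert L.P.mul_mem ((rotL (d : ℤ)).2 (by simpa using hd))
      (L.P.mul_mem (cj (-(d : ℤ)) hyk) hc') using 1
    rw [inv_pow]; group
  have := h.phi (c + d) 1 (i := r - 1) (by have := h.pos; omega) (b := u * L.Δ ^ (-p))
    (by simp) (by
      convert cj p huk using 1
      rw [hk, pow_succ]; push_cast; group)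
  convert cj (-p) this using 1; group

end LG
end Garside
namespace Garside
namespace LG

variable {G : Type*} [Group G] {L : LG G}

theorem eventually_periodic {α : Type*} {S : Set α} (hS : S.Finite) {c : α → α}
    (hc : ∀ y ∈ S, c y ∈ S) :
    ∀ᶠ m : ℕ in Filter.atTop, ∀ y ∈ S, ∃ t : ℕ, 1 ≤ t ∧ c^[t] (c^[m] y) = c^[m] y := by
  rw [Filter.eventually_all_finite hS]
  intro y hy
  have hmem : ∀ k : ℕ, c^[k] y ∈ S := by
    intro k
    induction k with
    | zero => exact hy
    | succ k ih => rw [Function.iterate_succ_apply']; exact hc _ ih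
  obtain ⟨a, b, hab, h⟩ := hS.exists_lt_map_eq_of_forall_mem hmem
  filter_upwards [Filter.eventually_ge_atTop a] with m hm
  refine ⟨b - a, by omega, ?_⟩
  obtain ⟨d, rfl⟩ := Nat.exists_eq_add_of_le hm
  rw [← Function.iterate_add_apply, show b - a + (a + d) = d + b by omega,
    Function.iterate_add_apply, ← h, ← Function.iterate_add_apply, add_comm]

theorem cyL_one {p : ℤ} {y : G} (h : L.Bd p 1 y) : L.cyL p y = L.Δ ^ p * y * L.Δ ^ (-p) := by
  have : L.iL p y = y * L.Δ ^ (-p) := by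
    have a := (L.iL_char p y (y * L.Δ ^ (-p))).2 ⟨by
      convert cj p h.hi using 1
      push_cast; group, by simp⟩
    have b : (L.iL p y)⁻¹ * (y * L.Δ ^ (-p)) ∈ L.P := L.gL₂ _ _
    have := L.anti _ a (by convert b using 1; group)
    exact (inv_mul_eq_one.1 this).symm
  rw [cyL, this]; group

theorem cyL_one_periodic {p : ℤ} {y : G} (h : L.Bd p 1 y) :
    ∃ t : ℕ, 1 ≤ t ∧ (L.cyL p)^[t] y = y := by
  obtain ⟨e, he, hc⟩ := L.central
  have key : ∀ k : ℕ, (L.cyL p)^[k] y = L.Δ ^ (k * p) * y * L.Δ ^ (-(k * p)) ∧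
      L.Bd p 1 ((L.cyL p)^[k] y) := by
    intro k
    induction k with
    | zero => simpa using h
    | succ k ih =>
      rw [Function.iterate_succ_apply']
      refine ⟨?_, ih.2.cyL le_rfl⟩
      rw [cyL_one ih.2, ih.1]; push_cast; group
  refine ⟨e, he, ?_⟩
  rw [(key e).1, zpow_mul, zpow_natCast, ((hc y).zpow_left p).eq, zpow_neg, zpow_mul, zpow_natCast]
  group

theorem cyR_one_periodic {p : ℤ} {y : G} (h : L.Bd p 1 y) :
    ∃ t : ℕ, 1 ≤ t ∧ (L.cyR p)^[t] y = y := by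
  obtain ⟨t, ht, h⟩ := cyL_one_periodic (op_Bd.2 h)
  rw [op_cyL_it] at h
  exact ⟨t, ht, MulOpposite.op_injective h⟩

variable (L) in
/-- left ultra summit set -/
def UL (p : ℤ) (r : ℕ) (x : G) : Set G :=
  {y | (IsConj x y ∧ L.Bd p r y) ∧ ∃ t : ℕ, 1 ≤ t ∧ (L.cyL p)^[t] y = y}
variable (L) in
/-- right ultra summit set -/
def UR (p : ℤ) (r : ℕ) (x : G) : Set G :=
  {y | (IsConj x y ∧ L.Bd p r y) ∧ ∃ t : ℕ, 1 ≤ t ∧ (L.cyR p)^[t] y = y}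
variable (L) in
/-- left arrows -/
def AL (p : ℤ) (r : ℕ) (x : G) : Set (G × G × G) :=
  {a | a.1 ∈ L.UL p r x ∧ a.2.2 ∈ L.UL p r x ∧ (a.2.1 ∈ L.P ∧ a.2.1⁻¹ * L.Δ ∈ L.P) ∧
    a.2.1⁻¹ * a.1 * a.2.1 = a.2.2}
variable (L) in
/-- reversed right arrows -/
def AR (p : ℤ) (r : ℕ) (x : G) : Set (G × G × G) :=
  {a | a.2.2 ∈ L.UR p r x ∧ a.1 ∈ L.UR p r x ∧ (a.2.1 ∈ L.P ∧ a.2.1⁻¹ * L.Δ ∈ L.P) ∧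
    a.2.1 * a.2.2 * a.2.1⁻¹ = a.1}

theorem isConj_cyL {p : ℤ} {x y : G} (h : IsConj x y) : IsConj x (L.cyL p y) :=
  h.trans (isConj_iff.2 ⟨(L.iL p y)⁻¹, by rw [cyL]; group⟩)
theorem isConj_cyR {p : ℤ} {x y : G} (h : IsConj x y) : IsConj x (L.cyR p y) :=
  h.trans (isConj_iff.2 ⟨L.iR p y, by rw [cyR]⟩)

theorem iso {p : ℤ} {r : ℕ} {x u : G} (h : L.Rig p r u) (hxu : IsConj x u) :
    ∃ (e : G → G) (f : G × G × G → G × G × G),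
      Set.BijOn e (L.UL p r x) (L.UR p r x) ∧
      Set.BijOn f (L.AL p r x) (L.AR p r x) ∧
      ∀ a ∈ L.AL p r x, (f a).1 = e a.1 ∧ (f a).2.2 = e a.2.2 := by
  have hr := h.pos
  rcases hr.eq_or_lt with rfl | hr2
  · have e1 : L.UL p 1 x = L.UR p 1 x := by
      ext y
      exact ⟨fun hy => ⟨hy.1, cyR_one_periodic hy.1.2⟩, fun hy => ⟨hy.1, cyL_one_periodic hy.1.2⟩⟩
    have e2 : L.AL p 1 x = L.AR p 1 x := by
      ext ⟨a, s, b⟩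
      simp only [AL, AR, Set.mem_setOf_eq, e1]
      constructor
      · rintro ⟨h1, h2, h3, rfl⟩
        exact ⟨h2, h1, h3, by group⟩
      · rintro ⟨h1, h2, h3, rfl⟩
        exact ⟨h2, h1, h3, by group⟩
    refine ⟨id, id, ?_, ?_, fun a _ => ⟨rfl, rfl⟩⟩
    · rw [e1]; exact Set.bijOn_id _
    · rw [e2]; exact Set.bijOn_id _
  · set S : Set G := {y | IsConj x y ∧ L.Bd p r y} with hS
    have hSf : S.Finite := (Bd_finite p r).subset fun y hy => hy.2
    have hSL : ∀ y ∈ S, L.cyL p y ∈ S := fun y hy => ⟨isConj_cyL hy.1, hy.2.cyL hr⟩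
    have hSR : ∀ y ∈ S, L.cyR p y ∈ S := fun y hy => ⟨isConj_cyR hy.1, hy.2.cyR hr⟩
    have hSLi : ∀ (k : ℕ), ∀ y ∈ S, (L.cyL p)^[k] y ∈ S := fun k => by
      induction k with
      | zero => exact fun y hy => hy
      | succ k ih => intro y hy; rw [Function.iterate_succ_apply']; exact hSL _ (ih y hy)
    have hSRi : ∀ (k : ℕ), ∀ y ∈ S, (L.cyR p)^[k] y ∈ S := fun k => by
      induction k with
      | zero => exact fun y hy => hy
      | succ k ih => intro y hy; rw [Function.iterate_succ_apply']; exact hSR _ (ih y hy)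
    obtain ⟨m, hmL, hmR⟩ := ((eventually_periodic hSf hSL).and
      (eventually_periodic hSf hSR)).exists_forall_of_atTop.imp
        (fun m hm => hm (r * m) (Nat.le_mul_of_pos_left m hr))
    set N := r * m with hN
    have mapL : ∀ y ∈ S, (L.cyL p)^[N] y ∈ L.UL p r x := fun y hy => ⟨hSLi N y hy, hmL y hy⟩
    have mapR : ∀ y ∈ S, (L.cyR p)^[N] y ∈ L.UR p r x := fun y hy => ⟨hSRi N y hy, hmR y hy⟩
    have rigR : ∀ w ∈ L.UR p r x, L.RigR p r w := by
      rintro w ⟨⟨h1, h2⟩, t, ht, h3⟩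
      obtain ⟨g, hg⟩ := isConj_iff.1 (hxu.symm.trans h1)
      exact h.rigR hg.symm hr2 h2 ht h3
    have hu0 := mapR u ⟨hxu, h.toBd⟩
    have rigL : ∀ w ∈ L.UL p r x, L.Rig p r w := by
      rintro w ⟨⟨h1, h2⟩, t, ht, h3⟩
      obtain ⟨g, hg⟩ := isConj_iff.1 (hu0.1.1.symm.trans h1)
      exact (rigR _ hu0).rig hg.symm hr2 h2 ht h3
    have thL : ∀ w ∈ L.UL p r x, L.CL p N ((L.cyR p)^[N] w) = L.CR p N w :=
      fun w hw => (rigL w hw).CL_CR m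
    have thR : ∀ w ∈ L.UR p r x, L.CR p N ((L.cyL p)^[N] w) = L.CL p N w :=
      fun w hw => (rigR w hw).CR_CL m
    have invL : ∀ w ∈ L.UL p r x, (L.cyL p)^[N] ((L.cyR p)^[N] w) = w := fun w hw => by
      rw [cyL_it, thL w hw, cyR_it]; group
    have invR : ∀ w ∈ L.UR p r x, (L.cyR p)^[N] ((L.cyL p)^[N] w) = w := fun w hw => by
      rw [cyR_it, thR w hw, cyL_it]; group
    refine ⟨(L.cyR p)^[N], fun a => ((L.cyR p)^[N] a.1,
      L.CR p N a.1 * a.2.1 * (L.CR p N a.2.2)⁻¹, (L.cyR p)^[N] a.2.2), ?_, ?_,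
      fun a _ => ⟨rfl, rfl⟩⟩
    · exact Set.InvOn.bijOn (f' := (L.cyL p)^[N]) ⟨invL, invR⟩
        (fun w hw => mapR w hw.1) (fun w hw => mapL w hw.1)
    · refine Set.InvOn.bijOn (f' := fun a => ((L.cyL p)^[N] a.1,
        (L.CL p N a.1)⁻¹ * a.2.1 * L.CL p N a.2.2, (L.cyL p)^[N] a.2.2)) ⟨?_, ?_⟩ ?_ ?_
      · rintro ⟨a, s, b⟩ ⟨h1, h2, h3, h4⟩
        simp only at h1 h2 h3 h4 ⊢
        rw [invL _ h1, invL _ h2, thL _ h1, thL _ h2]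
        congr 2
        group
      · rintro ⟨a, s, b⟩ ⟨h1, h2, h3, h4⟩
        simp only at h1 h2 h3 h4 ⊢
        rw [invR _ h1, invR _ h2, thR _ h1, thR _ h2]
        congr 2
        group
      · rintro ⟨a, s, b⟩ ⟨h1, h2, h3, h4⟩
        simp only at h1 h2 h3 h4
        have h5 : a * s = s * b := by rw [← h4]; group
        refine ⟨mapR _ h2.1, mapR _ h1.1, ⟨transR_pos N h3.1 h5, transR_simple N h3.1 h3.2 h5⟩, ?_⟩
        simp only
        rw [cyR_it, cyR_it, ← h4]; group
      · rintro ⟨a, s, b⟩ ⟨h1, h2, h3, h4⟩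
        simp only at h1 h2 h3 h4
        have h5 : a * s = s * b := by rw [← h4]; group
        refine ⟨mapL _ h2.1, mapL _ h1.1, transL_simple N h3.1 h3.2 h5, ?_⟩
        simp only
        rw [cyL_it, cyL_it, ← h4]; group

end LG
end Garside
namespace Garside

/-- Head lemma for normal lists. -/
theorem head_char {G : Type*} [Group G] {P : Submonoid G} {Δ : G}
    (hg : ∀ a b : G, ∃ d, d⁻¹ * a ∈ P ∧ d⁻¹ * b ∈ P ∧
      ∀ c, c⁻¹ * a ∈ P → c⁻¹ * b ∈ P → c⁻¹ * d ∈ P) (l : List G)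
    (hs : ∀ s ∈ l, s ∈ P ∧ s⁻¹ * Δ ∈ P ∧ Δ⁻¹ * s * Δ ∈ P)
    (hc : l.IsChain (fun s t => ∀ x, x⁻¹ * Δ ∈ P → x⁻¹ * (s * t) ∈ P → x⁻¹ * s ∈ P)) :
    ∀ x, x⁻¹ * Δ ∈ P → x⁻¹ * l.prod ∈ P → x⁻¹ * l.headD 1 ∈ P := by
  induction l with
  | nil => intro x _ h; simpa using h
  | cons a l ih =>
    intro x h1 h2
    cases l with
    | nil => simpa using h2
    | cons b l =>
      rw [List.isChain_cons_cons] at hc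
      have ha := hs a (by simp)
      have hs' : ∀ s ∈ b :: l, s ∈ P ∧ s⁻¹ * Δ ∈ P ∧ Δ⁻¹ * s * Δ ∈ P :=
        fun s h => hs s (List.mem_cons_of_mem _ h)
      have hyP : (b :: l).prod ∈ P := P.list_prod_mem (fun s h => (hs' s h).1)
      rw [List.prod_cons] at h2
      set y := (b :: l).prod with hy
      obtain ⟨d, d1, d2, d3⟩ := hg Δ (a * y)
      have ad : a⁻¹ * d ∈ P := d3 a ha.2.1 (by simpa using hyP)
      have xd := d3 x h1 h2
      have k := ih hs' hc.2 (a⁻¹ * d) (by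
        convert P.mul_mem d1 ha.2.2 using 1; group) (by
        convert d2 using 1; group)
      have k2 : d⁻¹ * a ∈ P := hc.1 d d1 (by
        convert k using 1; simp [mul_assoc])
      convert P.mul_mem xd k2 using 1
      simp

namespace GarsideGroup

variable {G : Type*} [Group G] (𝒢 : GarsideGroup G)

theorem simple_tau₂ {s : G} (h : Simple 𝒢.pos 𝒢.Δ s) : Simple 𝒢.pos 𝒢.Δ (𝒢.Δ⁻¹ * s * 𝒢.Δ) := by
  have h1 := (𝒢.divisors_Δ (s⁻¹ * 𝒢.Δ)).2 ⟨h.2, by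
    show 𝒢.Δ * (s⁻¹ * 𝒢.Δ)⁻¹ ∈ 𝒢.pos
    simpa using h.1⟩
  have h2 : 𝒢.Δ⁻¹ * s * 𝒢.Δ ∈ 𝒢.pos := by
    have : (s⁻¹ * 𝒢.Δ)⁻¹ * 𝒢.Δ ∈ 𝒢.pos := h1.2
    simpa using this
  refine (𝒢.divisors_Δ _).2 ⟨h2, ?_⟩
  show 𝒢.Δ * (𝒢.Δ⁻¹ * s * 𝒢.Δ)⁻¹ ∈ 𝒢.pos
  have : s⁻¹ * 𝒢.Δ ∈ 𝒢.pos := h.2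
  convert this using 1
  group

theorem simple_tau₁ {s : G} (h : Simple 𝒢.pos 𝒢.Δ s) : Simple 𝒢.pos 𝒢.Δ (𝒢.Δ * s * 𝒢.Δ⁻¹) := by
  have h0 : 𝒢.Δ * s⁻¹ ∈ 𝒢.pos := ((𝒢.divisors_Δ s).1 h).2
  have h1 := (𝒢.divisors_Δ (𝒢.Δ * s⁻¹)).1 ⟨h0, by
    show (𝒢.Δ * s⁻¹)⁻¹ * 𝒢.Δ ∈ 𝒢.pos
    simpa using h.1⟩
  have h2 : 𝒢.Δ * s * 𝒢.Δ⁻¹ ∈ 𝒢.pos := by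
    have : 𝒢.Δ * (𝒢.Δ * s⁻¹)⁻¹ ∈ 𝒢.pos := h1.2
    convert this using 1
    group
  refine ⟨h2, ?_⟩
  show (𝒢.Δ * s * 𝒢.Δ⁻¹)⁻¹ * 𝒢.Δ ∈ 𝒢.pos
  convert h0 using 1
  group

theorem Δ_ne_one : 𝒢.Δ ≠ 1 := by
  intro h
  have := 𝒢.lnf_unique 1 0 1 [] [] ⟨by simp, by simp, List.IsChain.nil⟩
    ⟨by simp [h], by simp, List.IsChain.nil⟩
  omega

theorem nf_gcd (a b : G) : ∃ d, d⁻¹ * a ∈ 𝒢.pos ∧ d⁻¹ * b ∈ 𝒢.pos ∧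
      ∀ c, c⁻¹ * a ∈ 𝒢.pos → c⁻¹ * b ∈ 𝒢.pos → c⁻¹ * d ∈ 𝒢.pos :=
  ⟨𝒢.gcdL a b, 𝒢.gcdL_dvd_left a b, 𝒢.gcdL_dvd_right a b, 𝒢.dvd_gcdL a b⟩

theorem nf_head {p : ℤ} {l : List G} {x : G} (h : IsLeftNF 𝒢.pos 𝒢.Δ 𝒢.gcdL p l x) :
    ∀ x, x⁻¹ * 𝒢.Δ ∈ 𝒢.pos → x⁻¹ * l.prod ∈ 𝒢.pos → x⁻¹ * l.headD 1 ∈ 𝒢.pos := by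
  refine head_char 𝒢.nf_gcd l (fun s hs => ⟨(h.2.1 s hs).1.1, (h.2.1 s hs).1.2,
    (𝒢.simple_tau₂ (h.2.1 s hs).1).1⟩) ?_
  refine List.IsChain.imp ?_ (show l.IsChain _ from h.2.2)
  intro s t hst x h1 h2
  have := 𝒢.dvd_gcdL (s * t) 𝒢.Δ x h2 h1
  rwa [hst] at this

theorem nf_not_Δ {p : ℤ} {l : List G} {x : G} (h : IsLeftNF 𝒢.pos 𝒢.Δ 𝒢.gcdL p l x) :
    ¬ 𝒢.Δ⁻¹ * l.prod ∈ 𝒢.pos := by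
  intro h'
  have := 𝒢.nf_head h 𝒢.Δ (by simp) h'
  cases l with
  | nil => exact 𝒢.Δ_ne_one (𝒢.pos_antisymm _ 𝒢.Δ_pos (by simpa using this))
  | cons a l =>
    have ha := h.2.1 a (by simp)
    have h3 : 𝒢.Δ⁻¹ * a ∈ 𝒢.pos := this
    have h4 : a⁻¹ * 𝒢.Δ ∈ 𝒢.pos := ha.1.2
    have := 𝒢.pos_antisymm _ h3 (by simpa using h4)
    exact ha.2.2 (inv_mul_eq_one.1 this).symm

theorem zpow_pos {k : ℤ} (hk : 0 ≤ k) : 𝒢.Δ ^ k ∈ 𝒢.pos := by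
  obtain ⟨n, rfl⟩ := Int.eq_ofNat_of_zero_le hk
  simpa using 𝒢.pos.pow_mem 𝒢.Δ_pos n

theorem nf_prod {p : ℤ} {l : List G} {x : G} (h : IsLeftNF 𝒢.pos 𝒢.Δ 𝒢.gcdL p l x) :
    l.prod ∈ 𝒢.pos := 𝒢.pos.list_prod_mem (fun s hs => (h.2.1 s hs).1.1)

theorem nf_nonneg {p : ℤ} {l : List G} {x : G} (h : IsLeftNF 𝒢.pos 𝒢.Δ 𝒢.gcdL p l x)
    (hx : x ∈ 𝒢.pos) : 0 ≤ p := by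
  by_contra hp
  apply 𝒢.nf_not_Δ h
  have := 𝒢.pos.mul_mem (𝒢.zpow_pos (k := -p - 1) (by omega)) hx
  convert this using 1
  rw [h.1]; group

theorem conj_list (φ : G →* G) (hφ : ∀ s, Simple 𝒢.pos 𝒢.Δ s → φ s ∈ 𝒢.pos) (l : List G)
    (hl : ∀ s ∈ l, Simple 𝒢.pos 𝒢.Δ s) : φ l.prod ∈ 𝒢.pos := by
  rw [map_list_prod]
  apply 𝒢.pos.list_prod_mem
  intro y hy
  obtain ⟨s, hs, rfl⟩ := List.mem_map.1 hy
  exact hφ s (hl s hs)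

theorem conj_pos (φ : G →* G) (hφ : ∀ s, Simple 𝒢.pos 𝒢.Δ s → φ s ∈ 𝒢.pos) (hΔ : φ 𝒢.Δ = 𝒢.Δ)
    (x : G) (hx : x ∈ 𝒢.pos) : φ x ∈ 𝒢.pos := by
  obtain ⟨⟨p, l⟩, h⟩ := 𝒢.lnf_exists x
  have hp := 𝒢.nf_nonneg h hx
  rw [h.1, map_mul, map_zpow, hΔ]
  exact 𝒢.pos.mul_mem (𝒢.zpow_pos hp) (𝒢.conj_list φ hφ l (fun s hs => (h.2.1 s hs).1))

theorem bound (g : G) : ∃ k : ℕ, 𝒢.Δ ^ k * g ∈ 𝒢.pos := by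
  obtain ⟨⟨p, l⟩, h⟩ := 𝒢.lnf_exists g
  refine ⟨p.natAbs, ?_⟩
  have := 𝒢.pos.mul_mem (𝒢.zpow_pos (k := p.natAbs + p) (by omega)) (𝒢.nf_prod h)
  convert this using 1
  rw [h.1, ← zpow_natCast]; group

theorem central (hfin : {s : G | Simple 𝒢.pos 𝒢.Δ s}.Finite) :
    ∃ e : ℕ, 1 ≤ e ∧ ∀ g : G, Commute (𝒢.Δ ^ e) g := by
  have h1 : ∀ s : G, ∃ d : ℕ, 1 ≤ d ∧ (Simple 𝒢.pos 𝒢.Δ s → Commute (𝒢.Δ ^ d) s) := by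
    intro s
    by_cases hs : Simple 𝒢.pos 𝒢.Δ s
    · have hm : ∀ k : ℕ, 𝒢.Δ ^ k * s * (𝒢.Δ ^ k)⁻¹ ∈ {s : G | Simple 𝒢.pos 𝒢.Δ s} := by
        intro k
        induction k with
        | zero => simpa using hs
        | succ k ih =>
          have := 𝒢.simple_tau₁ ih
          show Simple _ _ _
          convert this using 1
          rw [pow_succ']; group
      obtain ⟨a, b, hab, hk⟩ := hfin.exists_lt_map_eq_of_forall_mem hm
      obtain ⟨d, rfl⟩ := Nat.exists_eq_add_of_lt hab
      refine ⟨d + 1, by omega, fun _ => ?_⟩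
      rw [add_assoc, pow_add] at hk
      have : s = 𝒢.Δ ^ (d + 1) * s * (𝒢.Δ ^ (d + 1))⁻¹ := by
        have := congrArg (fun z => (𝒢.Δ ^ a)⁻¹ * z * 𝒢.Δ ^ a) hk
        simpa [mul_assoc] using this
      show 𝒢.Δ ^ (d + 1) * s = s * 𝒢.Δ ^ (d + 1)
      nth_rewrite 2 [this]
      group
    · exact ⟨1, le_rfl, fun h => absurd h hs⟩
  choose d hd hc using h1
  refine ⟨∏ s ∈ hfin.toFinset, d s, Nat.succ_le_of_lt (Finset.prod_pos (fun s _ => hd s)), fun g => ?_⟩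
  have hg : g ∈ Subgroup.closure {s : G | Simple 𝒢.pos 𝒢.Δ s} := by
    rw [𝒢.simples_generate]; trivial
  induction hg using Subgroup.closure_induction with
  | mem s hs =>
    obtain ⟨k, hk⟩ := Finset.dvd_prod_of_mem d (hfin.mem_toFinset.2 hs)
    rw [hk, pow_mul]
    exact (hc s hs).pow_left k
  | one => exact Commute.one_right _
  | mul a b _ _ ha hb => exact ha.mul_right hb
  | inv a _ ha => exact ha.inv_right

/-- The lattice core of a Garside group with finitely many divisors of powers of `Δ`. -/
def toLG (hfin : ∀ c : ℕ, {x : G | x ∈ 𝒢.pos ∧ x⁻¹ * 𝒢.Δ ^ c ∈ 𝒢.pos}.Finite) : LG G where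
  P := 𝒢.pos
  anti := 𝒢.pos_antisymm
  Δ := 𝒢.Δ
  Δ_mem := 𝒢.Δ_pos
  conj₁ := 𝒢.conj_pos (MulAut.conj 𝒢.Δ).toMonoidHom (fun s hs => (𝒢.simple_tau₁ hs).1) (by simp)
  conj₂ x hx := by
    have := 𝒢.conj_pos (MulAut.conj 𝒢.Δ⁻¹).toMonoidHom
      (fun s hs => by simpa using (𝒢.simple_tau₂ hs).1) (by simp) x hx
    simpa using this
  gL := 𝒢.gcdL
  gL₁ := 𝒢.gcdL_dvd_left
  gL₂ := 𝒢.gcdL_dvd_right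
  gL₃ := 𝒢.dvd_gcdL
  gR := 𝒢.gcdR
  gR₁ := 𝒢.gcdR_dvd_left
  gR₂ := 𝒢.gcdR_dvd_right
  gR₃ := 𝒢.dvd_gcdR
  bound := 𝒢.bound
  central := 𝒢.central (by
    refine (hfin 1).subset ?_
    rintro s ⟨h1, h2⟩
    exact ⟨h1, by rw [pow_one]; exact h2⟩)
  fin := hfin

end GarsideGroup

/-- length homomorphism -/
def lenHom (n : ℕ) : BraidGroup n →* Multiplicative ℤ :=
  PresentedGroup.toGroup (f := fun _ => Multiplicative.ofAdd 1) (by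
    rintro r (⟨i, j, _, rfl⟩ | ⟨i, j, _, rfl⟩)
    · simp
    · simp)

theorem lenHom_σ (n : ℕ) (i : Fin (n - 1)) : lenHom n (σB n i) = Multiplicative.ofAdd 1 :=
  PresentedGroup.toGroup.of _

theorem lenHom_list (n : ℕ) (l : List (Fin (n - 1))) :
    lenHom n (l.map (σB n)).prod = Multiplicative.ofAdd (l.length : ℤ) := by
  induction l with
  | nil => simp
  | cons a l ih =>
    rw [List.map_cons, List.prod_cons, map_mul, lenHom_σ, ih, ← ofAdd_add, List.length_cons]
    push_cast; rw [add_comm]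

theorem pos_list (n : ℕ) {x : BraidGroup n} (hx : x ∈ Submonoid.closure (Set.range (σB n))) :
    ∃ l : List (Fin (n - 1)), x = (l.map (σB n)).prod := by
  induction hx using Submonoid.closure_induction with
  | mem x hx => obtain ⟨i, rfl⟩ := hx; exact ⟨[i], by simp⟩
  | one => exact ⟨[], by simp⟩
  | mul a b _ _ ha hb =>
    obtain ⟨l, rfl⟩ := ha
    obtain ⟨m, rfl⟩ := hb
    exact ⟨l ++ m, by simp⟩

theorem braid_fin {n : ℕ} (𝒢 : GarsideGroup (BraidGroup n)) (h𝒢 : IsBraidGarside n 𝒢) (c : ℕ) :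
    {x : BraidGroup n | x ∈ 𝒢.pos ∧ x⁻¹ * 𝒢.Δ ^ c ∈ 𝒢.pos}.Finite := by
  rw [h𝒢.1]
  set B := (Multiplicative.toAdd (lenHom n (𝒢.Δ ^ c))).toNat with hB
  refine ((List.finite_length_le (Fin (n - 1)) B).image
    (fun l => (l.map (σB n)).prod)).subset ?_
  rintro x ⟨h1, h2⟩
  obtain ⟨l, rfl⟩ := pos_list n h1
  obtain ⟨m, hm⟩ := pos_list n h2
  refine ⟨l, ?_, rfl⟩
  have : 𝒢.Δ ^ c = ((l ++ m).map (σB n)).prod := by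
    rw [List.map_append, List.prod_append, ← hm]; group
  show l.length ≤ B
  rw [hB, this, lenHom_list, toAdd_ofAdd, List.length_append]
  omega

end Garside
namespace Garside

namespace LG
variable {G : Type*} [Group G] {L : LG G}

variable (L) in
/-- normal list -/
def Nrm (l : List G) : Prop :=
  (∀ s ∈ l, s ∈ L.P ∧ s⁻¹ * L.Δ ∈ L.P) ∧
    l.IsChain (fun s t => ∀ x, x⁻¹ * L.Δ ∈ L.P → x⁻¹ * (s * t) ∈ L.P → x⁻¹ * s ∈ L.P)

theorem Nrm.head {l : List G} (h : L.Nrm l) :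
    ∀ x, x⁻¹ * L.Δ ∈ L.P → x⁻¹ * l.prod ∈ L.P → x⁻¹ * l.headD 1 ∈ L.P :=
  head_char (fun a b => ⟨L.gL a b, L.gL₁ a b, L.gL₂ a b, L.gL₃ a b⟩) l
    (fun s hs => ⟨(h.1 s hs).1, (h.1 s hs).2, L.conj₂ _ (h.1 s hs).1⟩) h.2

theorem Nrm.tail {a : G} {l : List G} (h : L.Nrm (a :: l)) : L.Nrm l :=
  ⟨fun s hs => h.1 s (List.mem_cons_of_mem _ hs), (List.isChain_cons.1 h.2).2⟩

theorem Nrm.pre {m l : List G} (h : L.Nrm (m ++ l)) :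
    ∀ x, x⁻¹ * L.Δ ^ (m.length : ℤ) ∈ L.P → x⁻¹ * (m ++ l).prod ∈ L.P → x⁻¹ * m.prod ∈ L.P := by
  induction m with
  | nil => intro x hx _; simpa using hx
  | cons a m ih =>
    intro x h1 h2
    have hh := h.head
    have k := F3 (L := L) (a := a) (z := (a :: m ++ l).prod) (d := x) (k := 1) (i := m.length)
      (by positivity) (fun x k1 k2 => hh x (by simpa using k1) k2) h2 (by
        convert h1 using 3
        rw [List.length_cons]; push_cast; ring)
    have := ih h.tail (a⁻¹ * x) k (by
      convert h2 using 1
      simp [mul_assoc])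
    convert this using 1
    simp [mul_assoc]

theorem Nrm.le {l : List G} (h : L.Nrm l) : l.prod⁻¹ * L.Δ ^ (l.length : ℤ) ∈ L.P := by
  induction l with
  | nil => simp
  | cons a l ih =>
    have h1 := ih h.tail
    have h2 := (h.1 a (by simp)).2
    convert L.P.mul_mem h1 (cj (-(l.length : ℤ)) h2) using 1
    rw [List.prod_cons, List.length_cons]; push_cast; group

theorem Nrm.not_le {l : List G} (h : L.Nrm l) (hl : l ≠ []) (h1 : ∀ s ∈ l, s ≠ 1) :
    ¬ l.prod⁻¹ * L.Δ ^ ((l.length : ℤ) - 1) ∈ L.P := by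
  intro h'
  obtain ⟨m, t, rfl⟩ : ∃ m t, l = m ++ [t] := ⟨_, _, (List.dropLast_append_getLast hl).symm⟩
  have := h.pre (m ++ [t]).prod (by convert h' using 3; simp) (by simp)
  apply h1 t (by simp)
  refine L.anti t (h.1 t (by simp)).1 ?_
  convert this using 1
  simp

end LG

namespace GarsideGroup
variable {G : Type*} [Group G] {𝒢 : GarsideGroup G}

theorem lnf_spec (x : G) : IsLeftNF 𝒢.pos 𝒢.Δ 𝒢.gcdL (𝒢.inf x) (𝒢.lnf x).2 x :=
  Classical.choose_spec (𝒢.lnf_exists x)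
theorem rnf_spec (x : G) : IsRightNF 𝒢.pos 𝒢.Δ 𝒢.gcdR (𝒢.rnf x).1 (𝒢.rnf x).2 x :=
  Classical.choose_spec (𝒢.rnf_exists x)

theorem nrm_of
    (hfin : ∀ c : ℕ, {x : G | x ∈ 𝒢.pos ∧ x⁻¹ * 𝒢.Δ ^ c ∈ 𝒢.pos}.Finite)
    {p : ℤ} {l : List G} {x : G} (h : IsLeftNF 𝒢.pos 𝒢.Δ 𝒢.gcdL p l x) :
    (𝒢.toLG hfin).Nrm l := by
  refine ⟨fun s hs => (h.2.1 s hs).1, ?_⟩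
  refine List.IsChain.imp ?_ (show l.IsChain _ from h.2.2)
  intro s t hst x h1 h2
  have := 𝒢.dvd_gcdL (s * t) 𝒢.Δ x h2 h1
  rwa [hst] at this

theorem bd
    (hfin : ∀ c : ℕ, {x : G | x ∈ 𝒢.pos ∧ x⁻¹ * 𝒢.Δ ^ c ∈ 𝒢.pos}.Finite)
    (x : G) : (𝒢.toLG hfin).Bd (𝒢.inf x) (𝒢.len x) x := by
  have h := 𝒢.lnf_spec x
  set p := 𝒢.inf x
  refine ⟨?_, ?_⟩
  · have := LG.cj (L := 𝒢.toLG hfin) p (𝒢.nf_prod h)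
    convert this using 1
    nth_rewrite 1 [h.1]
    rfl
  · have := (nrm_of hfin h).le
    convert this using 1
    nth_rewrite 1 [h.1]
    show _ * 𝒢.Δ ^ (p + ((𝒢.lnf x).2.length : ℤ)) = _ * 𝒢.Δ ^ _
    group

theorem not_inf (x : G) : ¬ 𝒢.Δ ^ (-(𝒢.inf x + 1)) * x ∈ 𝒢.pos := by
  intro h'
  have h := 𝒢.lnf_spec x
  apply 𝒢.nf_not_Δ h
  convert h' using 1
  nth_rewrite 3 [h.1]
  group

theorem not_sup
    (hfin : ∀ c : ℕ, {x : G | x ∈ 𝒢.pos ∧ x⁻¹ * 𝒢.Δ ^ c ∈ 𝒢.pos}.Finite)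
    (x : G) (hl : (𝒢.lnf x).2 ≠ []) :
    ¬ x⁻¹ * 𝒢.Δ ^ (𝒢.inf x + 𝒢.len x - 1) ∈ 𝒢.pos := by
  intro h'
  have h := 𝒢.lnf_spec x
  apply (nrm_of hfin h).not_le hl (fun s hs => (h.2.1 s hs).2.1)
  show _ * 𝒢.Δ ^ ((𝒢.len x : ℤ) - 1) ∈ 𝒢.pos
  convert h' using 1
  nth_rewrite 3 [h.1]
  group

theorem iotaL_eq
    (hfin : ∀ c : ℕ, {x : G | x ∈ 𝒢.pos ∧ x⁻¹ * 𝒢.Δ ^ c ∈ 𝒢.pos}.Finite)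
    (y : G) : 𝒢.iotaL y = (𝒢.toLG hfin).iL (𝒢.inf y) y := by
  have h := 𝒢.lnf_spec y
  have hn := nrm_of hfin h
  set L := 𝒢.toLG hfin with hL
  have e : 𝒢.iotaL y = L.Δ ^ (𝒢.inf y) * (𝒢.lnf y).2.headD 1 * L.Δ ^ (-(𝒢.inf y)) := by
    show 𝒢.Δ ^ (- -(𝒢.inf y)) * _ * 𝒢.Δ ^ (-(𝒢.inf y)) = _
    rw [neg_neg]; rfl
  have hy : y * L.Δ ^ (-𝒢.inf y) = L.Δ ^ (𝒢.inf y) * (𝒢.lnf y).2.prod * L.Δ ^ (-(𝒢.inf y)) := by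
    nth_rewrite 1 [h.1]; rfl
  have hd : ((𝒢.lnf y).2.headD 1)⁻¹ * L.Δ ∈ L.P ∧
      ((𝒢.lnf y).2.headD 1)⁻¹ * (𝒢.lnf y).2.prod ∈ L.P := by
    cases hl : (𝒢.lnf y).2 with
    | nil => simpa using L.Δ_mem
    | cons a l =>
      rw [hl] at hn
      refine ⟨(hn.1 a (by simp)).2, ?_⟩
      simpa using L.P.list_prod_mem (fun s hs => (hn.tail.1 s hs).1)
  rw [e]
  have a := (L.iL_char (𝒢.inf y) y (L.Δ ^ (𝒢.inf y) * (𝒢.lnf y).2.headD 1 * L.Δ ^ (-(𝒢.inf y)))).2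
    ⟨by convert LG.cj (𝒢.inf y) hd.1 using 1; group, by
      rw [hy]; convert LG.cj (𝒢.inf y) hd.2 using 1; group⟩
  have b := (L.iL_char (𝒢.inf y) y (L.iL (𝒢.inf y) y)).1 (by simp)
  rw [hy] at b
  have c := hn.head (L.Δ ^ (-(𝒢.inf y)) * L.iL (𝒢.inf y) y * L.Δ ^ (𝒢.inf y))
    (by convert LG.cj (-𝒢.inf y) b.1 using 1; group)
    (by convert LG.cj (-𝒢.inf y) b.2 using 1; group)
  have := L.anti _ a (by convert LG.cj (𝒢.inf y) c using 1; group)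
  exact inv_mul_eq_one.1 this

theorem nrm_op
    (hfin : ∀ c : ℕ, {x : G | x ∈ 𝒢.pos ∧ x⁻¹ * 𝒢.Δ ^ c ∈ 𝒢.pos}.Finite)
    {p : ℤ} {l : List G} {x : G} (h : IsRightNF 𝒢.pos 𝒢.Δ 𝒢.gcdR p l x) :
    (𝒢.toLG hfin).op.Nrm (l.map MulOpposite.op).reverse := by
  refine ⟨fun s hs => ?_, ?_⟩
  · rw [List.mem_reverse, List.mem_map] at hs
    obtain ⟨s, hs, rfl⟩ := hs
    have := (𝒢.divisors_Δ s).1 (h.2.1 s hs).1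
    exact ⟨this.1, this.2⟩
  · rw [List.isChain_reverse, List.isChain_map]
    refine List.IsChain.imp ?_ (show l.IsChain _ from h.2.2)
    intro s t hst x h1 h2
    have := 𝒢.dvd_gcdR (s * t) 𝒢.Δ x.unop h2 h1
    rw [hst] at this
    exact this

theorem rnf_inf (y : G) : (𝒢.rnf y).1 = 𝒢.inf y :=
  (𝒢.lnf_rnf_agree y _ _ _ _ (𝒢.lnf_spec y) (𝒢.rnf_spec y)).1.symm

theorem iotaR_eq
    (hfin : ∀ c : ℕ, {x : G | x ∈ 𝒢.pos ∧ x⁻¹ * 𝒢.Δ ^ c ∈ 𝒢.pos}.Finite)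
    (y : G) : 𝒢.iotaR y = (𝒢.toLG hfin).iR (𝒢.inf y) y := by
  have h := 𝒢.rnf_spec y
  have hn := nrm_op hfin h
  have hpos : (𝒢.rnf y).2.prod ∈ 𝒢.pos := 𝒢.pos.list_prod_mem (fun s hs => (h.2.1 s hs).1.1)
  rw [iotaR, rnf_inf]
  rw [rnf_inf] at h
  set p := 𝒢.inf y with hp
  set L := 𝒢.toLG hfin with hL
  set l := (𝒢.rnf y).2 with hl
  set q := l.getLast?.getD 1 with hq
  have hhead : (l.map MulOpposite.op).reverse.headD 1 = MulOpposite.op q := by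
    rw [List.headD_eq_head?_getD, List.head?_reverse, List.getLast?_map, hq]
    cases l.getLast? <;> simp
  have H := hn.head
  rw [hhead, ← MulOpposite.op_list_prod] at H
  have H' : ∀ x : G, L.Δ * x⁻¹ ∈ L.P → l.prod * x⁻¹ ∈ L.P → q * x⁻¹ ∈ L.P :=
    fun x h1 h2 => H (MulOpposite.op x) h1 h2
  have hy : L.Δ ^ (-p) * y = L.Δ ^ (-p) * l.prod * L.Δ ^ p := by
    rw [h.1, mul_assoc]; rfl
  have hd : L.Δ * q⁻¹ ∈ L.P ∧ l.prod * q⁻¹ ∈ L.P := by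
    rcases List.eq_nil_or_concat l with h0 | ⟨m, a, h0⟩
    · rw [hq, h0]; simpa using L.Δ_mem
    · have hqa : q = a := by rw [hq, h0]; simp
      have hs := h.2.1
      rw [h0] at hs
      rw [hqa, h0]
      refine ⟨((𝒢.divisors_Δ a).1 (hs a (by simp)).1).2, ?_⟩
      simp only [List.concat_eq_append, List.prod_append, List.prod_singleton, mul_inv_cancel_right]
      exact L.P.list_prod_mem (fun s k => (hs s (by simp [k])).1.1)
  have a : L.iR p y * (L.Δ ^ (-p) * q * L.Δ ^ p)⁻¹ ∈ L.P := by
    refine L.gR₃ _ _ _ ?_ ?_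
    · convert LG.cj (-p) hd.1 using 1; group
    · rw [hy]; convert LG.cj (-p) hd.2 using 1; group
  have b1 : L.Δ * (L.iR p y)⁻¹ ∈ L.P := L.gR₁ _ _
  have b2 : (L.Δ ^ (-p) * y) * (L.iR p y)⁻¹ ∈ L.P := L.gR₂ _ _
  rw [hy] at b2
  have c := H' (L.Δ ^ p * L.iR p y * L.Δ ^ (-p)) (by convert LG.cj p b1 using 1; group)
    (by convert LG.cj p b2 using 1; group)
  have := L.anti _ a (by convert LG.cj (-p) c using 1; group)
  exact (mul_inv_eq_one.1 this).symm

theorem rig_of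
    (hfin : ∀ c : ℕ, {x : G | x ∈ 𝒢.pos ∧ x⁻¹ * 𝒢.Δ ^ c ∈ 𝒢.pos}.Finite)
    {u : G} (h : 𝒢.LeftRigid u) : (𝒢.toLG hfin).Rig (𝒢.inf u) (𝒢.len u) u := by
  obtain ⟨h1, h2⟩ := h
  refine ⟨bd hfin u, List.length_pos_of_ne_nil h1, fun x k1 k2 => ?_⟩
  have hn := nrm_of hfin h2
  have hu := 𝒢.lnf_spec u
  rw [← iotaL_eq] at k2
  set L := 𝒢.toLG hfin with hL
  have e1 : u = L.Δ ^ (𝒢.inf u) * (𝒢.lnf u).2.prod := hu.1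
  have := hn.pre (L.Δ ^ (-𝒢.inf u) * x) (by
    convert k1 using 1
    show _ * L.Δ ^ (𝒢.len u : ℤ) = _
    group) (by
    convert k2 using 1
    have e2 : u * 𝒢.iotaL u = L.Δ ^ (𝒢.inf u) * ((𝒢.lnf u).2.prod * 𝒢.iotaL u) := by
      rw [← mul_assoc, ← e1]
    rw [e2]
    simp [mul_assoc])
  nth_rewrite 1 [e1]
  convert this using 1
  group

theorem final
    (hfin : ∀ c : ℕ, {x : G | x ∈ 𝒢.pos ∧ x⁻¹ * 𝒢.Δ ^ c ∈ 𝒢.pos}.Finite)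
    {x u : G} (hxu : IsConj x u) (hu : 𝒢.LeftRigid u) : ∃ (e : G → G)
      (f : G × G × G → G × G × G),
      Set.BijOn e (𝒢.USSL x) (𝒢.USSR x) ∧
      Set.BijOn f (𝒢.ArrL x) {a | (a.2.2, a.2.1, a.1) ∈ 𝒢.ArrR x} ∧
      ∀ a ∈ 𝒢.ArrL x, (f a).1 = e a.1 ∧ (f a).2.2 = e a.2.2 := by
  have hrig := rig_of hfin hu
  have hni := 𝒢.not_inf u
  have hns := not_sup hfin u hu.1
  set p := 𝒢.inf u with hp
  set r := 𝒢.len u with hr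
  set L := 𝒢.toLG hfin with hL
  have ext1 : ∀ y, IsConj x y → 𝒢.inf y ≤ p ∧ p + r ≤ 𝒢.inf y + 𝒢.len y := by
    intro y hy
    obtain ⟨g, hg⟩ := isConj_iff.1 (hy.symm.trans hxu)
    have b := bd hfin y
    exact ⟨hrig.inf_max hni hg.symm ((LG.rotL _).1 b.lo), hrig.sup_min hns hg.symm b.hi⟩
  have ext2 : ∀ y, IsConj x y → L.Bd p r y → 𝒢.inf y = p ∧ 𝒢.len y = r := by
    intro y hy b
    obtain ⟨e1, e2⟩ := ext1 y hy
    have e3 : p ≤ 𝒢.inf y := by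
      by_contra hlt
      apply 𝒢.not_inf y
      have := LG.mulΔ (L := L) (k := p - (𝒢.inf y + 1)) (by omega) ((LG.rotL _).1 b.lo)
      change _ ∈ L.P
      convert this using 1
      show _ = 𝒢.Δ ^ _ * (𝒢.Δ ^ _ * y)
      group
    have hl : (𝒢.lnf y).2 ≠ [] := by
      intro h0
      have : 𝒢.len y = 0 := by rw [len, h0]; rfl
      have := hrig.pos
      omega
    have e4 : 𝒢.inf y + 𝒢.len y ≤ p + r := by
      by_contra hlt
      apply not_sup hfin y hl
      have := LG.tot (L := L) (a := 0) (b := 𝒢.inf y + 𝒢.len y - 1 - (p + r)) b.hi (by omega)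
      change _ ∈ L.P
      convert this using 1
      show _ = 𝒢.Δ ^ _ * (_ * 𝒢.Δ ^ _) * 𝒢.Δ ^ _
      group
    omega
  have sss : ∀ y, y ∈ 𝒢.SSS x ↔ IsConj x y ∧ L.Bd p r y := by
    intro y
    constructor
    · rintro ⟨h1, h2⟩
      have h3 := h2 u hxu
      have h4 := ext1 y h1
      have e1 : 𝒢.inf y = p := by omega
      have e2 : 𝒢.len y = r := by omega
      have := bd hfin y
      rw [e1, e2] at this
      exact ⟨h1, this⟩
    · rintro ⟨h1, h2⟩
      refine ⟨h1, fun z hz => ?_⟩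
      have h3 := ext2 y h1 h2
      have h4 := ext1 z hz
      omega
  have hcL : ∀ y, IsConj x y → L.Bd p r y → 𝒢.cL y = L.cyL p y := by
    intro y h1 h2
    rw [cL, iotaL_eq hfin, (ext2 y h1 h2).1]; rfl
  have hcR : ∀ y, IsConj x y → L.Bd p r y → 𝒢.cR y = L.cyR p y := by
    intro y h1 h2
    rw [cR, iotaR_eq hfin, (ext2 y h1 h2).1]; rfl
  have hiL : ∀ y, IsConj x y → L.Bd p r y → ∀ t : ℕ, (𝒢.cL)^[t] y = (L.cyL p)^[t] y := by
    intro y h1 h2 t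
    induction t generalizing y with
    | zero => rfl
    | succ t ih =>
      rw [Function.iterate_succ_apply, Function.iterate_succ_apply, hcL y h1 h2]
      exact ih _ (LG.isConj_cyL h1) (h2.cyL hrig.pos)
  have hiR : ∀ y, IsConj x y → L.Bd p r y → ∀ t : ℕ, (𝒢.cR)^[t] y = (L.cyR p)^[t] y := by
    intro y h1 h2 t
    induction t generalizing y with
    | zero => rfl
    | succ t ih =>
      rw [Function.iterate_succ_apply, Function.iterate_succ_apply, hcR y h1 h2]
      exact ih _ (LG.isConj_cyR h1) (h2.cyR hrig.pos)
  have eL : 𝒢.USSL x = L.UL p r x := by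
    ext y
    constructor
    · rintro ⟨h1, t, ht, h2⟩
      have h3 := (sss y).1 h1
      exact ⟨h3, t, ht, by rw [← hiL y h3.1 h3.2, h2]⟩
    · rintro ⟨h3, t, ht, h2⟩
      exact ⟨(sss y).2 h3, t, ht, by rw [hiL y h3.1 h3.2, h2]⟩
  have eR : 𝒢.USSR x = L.UR p r x := by
    ext y
    constructor
    · rintro ⟨h1, t, ht, h2⟩
      have h3 := (sss y).1 h1
      exact ⟨h3, t, ht, by rw [← hiR y h3.1 h3.2, h2]⟩
    · rintro ⟨h3, t, ht, h2⟩
      exact ⟨(sss y).2 h3, t, ht, by rw [hiR y h3.1 h3.2, h2]⟩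
  have aL : 𝒢.ArrL x = L.AL p r x := by rw [ArrL, eL]; rfl
  have aR : {a : G × G × G | (a.2.2, a.2.1, a.1) ∈ 𝒢.ArrR x} = L.AR p r x := by
    rw [ArrR, eR]; rfl
  rw [eL, eR, aL, aR]
  exact LG.iso hrig hxu

end GarsideGroup
end Garside
namespace Garside

/-- **Theorem 3.** Let `x ∈ Bₙ` with `ℓ(x) > 1` be conjugate to a left rigid
braid. Then the (labeled directed) graphs `USG_L(x)` and `USG_R(x)^op` are
isomorphic: there is a bijection on vertices and a bijection on arrows which
preserves sources and targets. -/
theorem USGL_iso_USGR_op {n : ℕ} (𝒢 : GarsideGroup (BraidGroup n))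
    (h𝒢 : IsBraidGarside n 𝒢) (x : BraidGroup n) (hx : 1 < 𝒢.len x)
    (hconj : ∃ y, IsConj x y ∧ 𝒢.LeftRigid y) :
    ∃ (e : BraidGroup n → BraidGroup n)
      (f : BraidGroup n × BraidGroup n × BraidGroup n →
        BraidGroup n × BraidGroup n × BraidGroup n),
      Set.BijOn e (𝒢.USSL x) (𝒢.USSR x) ∧
      Set.BijOn f (𝒢.ArrL x) {a | (a.2.2, a.2.1, a.1) ∈ 𝒢.ArrR x} ∧
      ∀ a ∈ 𝒢.ArrL x, (f a).1 = e a.1 ∧ (f a).2.2 = e a.2.2 := by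
  obtain ⟨y, h1, h2⟩ := hconj
  exact GarsideGroup.final (braid_fin 𝒢 h𝒢) h1 h2

end Garside
end

section
/- Let G be a Garside group and let x ∈ SSS(x) ⊆ G. If x is conjugate to a left rigid or to a right rigid element, then x is periodically geodesic, i.e. inf(x^m) = m·inf(x) and sup(x^m) = m·sup(x) for every m ≥ 1. -/
namespace Garside

namespace GarsideGroup

variable {G : Type*} [Group G] (𝒢 : GarsideGroup G)

theorem inf_of_lnf {x : G} {p : ℤ} {l : List G}
    (h : IsLeftNF 𝒢.pos 𝒢.Δ 𝒢.gcdL p l x) : 𝒢.inf x = p ∧ 𝒢.len x = l.length := by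
  have h0 := Classical.choose_spec (𝒢.lnf_exists x)
  have := 𝒢.lnf_unique x _ _ _ _ h0 h
  exact ⟨this.1, congrArg List.length this.2⟩

theorem inf_of_rnf {x : G} {p : ℤ} {l : List G}
    (h : IsRightNF 𝒢.pos 𝒢.Δ 𝒢.gcdR p l x) : 𝒢.inf x = p ∧ 𝒢.len x = l.length :=
  𝒢.lnf_rnf_agree x _ _ _ _ (Classical.choose_spec (𝒢.lnf_exists x)) h

theorem zpow_ne {n : ℤ} (hn : n ≠ 0) : 𝒢.Δ ^ n ≠ 1 := by
  intro h
  have h1 : IsLeftNF 𝒢.pos 𝒢.Δ 𝒢.gcdL n [] 1 := by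
    refine ⟨by simp [h], by simp, by simp [List.Chain']⟩
  have h0 : IsLeftNF 𝒢.pos 𝒢.Δ 𝒢.gcdL 0 [] 1 := by
    refine ⟨by simp, by simp, by simp [List.Chain']⟩
  exact hn (𝒢.lnf_unique _ _ _ _ _ h1 h0).1

theorem dvd_antisymm {a b : G} (h1 : LeftDvd 𝒢.pos a b) (h2 : LeftDvd 𝒢.pos b a) : a = b := by
  have := 𝒢.pos_antisymm (a⁻¹ * b) h1 (by simpa [LeftDvd] using h2)
  exact inv_mul_eq_one.1 this

theorem dvdR_antisymm {a b : G} (h1 : RightDvd 𝒢.pos a b) (h2 : RightDvd 𝒢.pos b a) : a = b := by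
  have := 𝒢.pos_antisymm (b * a⁻¹) h1 (by simpa [RightDvd] using h2)
  exact (mul_inv_eq_one.1 this).symm

theorem dvd_trans {a b c : G} (h1 : LeftDvd 𝒢.pos a b) (h2 : LeftDvd 𝒢.pos b c) :
    LeftDvd 𝒢.pos a c := by
  have := 𝒢.pos.mul_mem h1 h2
  simpa [LeftDvd, mul_assoc] using this

/-- A list of proper simple elements, consecutive ones left weighted. -/
def LW (l : List G) : Prop :=
  (∀ s ∈ l, Simple 𝒢.pos 𝒢.Δ s ∧ s ≠ 1 ∧ s ≠ 𝒢.Δ) ∧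
    l.IsChain (fun s t => 𝒢.gcdL (s * t) 𝒢.Δ = s)

theorem LW.pos {l : List G} (h : 𝒢.LW l) : l.prod ∈ 𝒢.pos :=
  Submonoid.list_prod_mem _ fun s hs => (h.1 s hs).1.1

theorem LW.tail {a : G} {l : List G} (h : 𝒢.LW (a :: l)) : 𝒢.LW l :=
  ⟨fun s hs => h.1 s (List.mem_cons_of_mem _ hs), h.2.tail⟩

theorem compl_simple {s : G} (h : Simple 𝒢.pos 𝒢.Δ s) : Simple 𝒢.pos 𝒢.Δ (s⁻¹ * 𝒢.Δ) := by
  refine (𝒢.divisors_Δ _).2 ⟨h.2, ?_⟩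
  simpa [RightDvd] using h.1

theorem compl_simple' {s : G} (h : Simple 𝒢.pos 𝒢.Δ s) : Simple 𝒢.pos 𝒢.Δ (𝒢.Δ * s⁻¹) := by
  have h' := (𝒢.divisors_Δ _).1 h
  refine ⟨h'.2, ?_⟩
  simpa [LeftDvd] using h.1

/-- Any simple left divisor of a left weighted product divides the first factor. -/
theorem LW.dvd_head {a : G} {l : List G} (h : 𝒢.LW (a :: l)) :
    ∀ c, LeftDvd 𝒢.pos c (a :: l).prod → LeftDvd 𝒢.pos c 𝒢.Δ → LeftDvd 𝒢.pos c a := by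
  induction l generalizing a with
  | nil => intro c h1 _; simpa using h1
  | cons b l ih =>
    intro c h1 h2
    have hab : 𝒢.gcdL (a * b) 𝒢.Δ = a := by
      have := h.2
      simp only [List.isChain_cons_cons] at this
      exact this.1
    have hb := ih h.tail
    have ha := (h.1 a (by simp)).1
    -- the gcd of the tail with the complement of `a`
    set d := 𝒢.gcdL (b :: l).prod (a⁻¹ * 𝒢.Δ) with hd
    have hcd : LeftDvd 𝒢.pos (a⁻¹ * c) d := by
      apply 𝒢.dvd_gcdL
      · simpa [LeftDvd, mul_assoc] using h1
      · simpa [LeftDvd, mul_assoc] using h2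
    have hdΔ : LeftDvd 𝒢.pos d 𝒢.Δ :=
      𝒢.dvd_trans (𝒢.gcdL_dvd_right _ _) (𝒢.compl_simple ha).2
    have hdb : LeftDvd 𝒢.pos d b := hb d (𝒢.gcdL_dvd_left _ _) hdΔ
    have hcb : LeftDvd 𝒢.pos (a⁻¹ * c) b := 𝒢.dvd_trans hcd hdb
    rw [← hab]
    apply 𝒢.dvd_gcdL
    · simpa [LeftDvd, mul_assoc] using hcb
    · exact h2

theorem LW.not_dvd {l : List G} (h : 𝒢.LW l) {k : ℕ} (hk : 0 < k) :
    𝒢.Δ ^ (-(k : ℤ)) * l.prod ∉ 𝒢.pos := by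
  intro hmem
  obtain ⟨k, rfl⟩ : ∃ j, k = j + 1 := ⟨k - 1, by omega⟩
  have h1 : LeftDvd 𝒢.pos 𝒢.Δ l.prod := by
    have := 𝒢.pos.mul_mem (𝒢.pos.pow_mem 𝒢.Δ_pos k) hmem
    have e : 𝒢.Δ ^ k * (𝒢.Δ ^ (-((k + 1 : ℕ) : ℤ)) * l.prod) = 𝒢.Δ⁻¹ * l.prod := by
      rw [← mul_assoc, ← zpow_natCast, ← zpow_add, ← zpow_neg_one]
      congr 2
      push_cast; ring
    rwa [e] at this
  cases l with
  | nil =>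
    have : 𝒢.Δ = 1 := 𝒢.pos_antisymm _ 𝒢.Δ_pos (by simpa [LeftDvd] using h1)
    exact 𝒢.zpow_ne (n := 1) one_ne_zero (by simpa using this)
  | cons a l =>
    have h2 := h.dvd_head 𝒢 𝒢.Δ h1 (by simp [LeftDvd, 𝒢.pos.one_mem])
    have ha := h.1 a (by simp)
    exact ha.2.2 (𝒢.dvd_antisymm ha.1.2 h2)

theorem lnf_spec_s5 (x : G) : x = 𝒢.Δ ^ (𝒢.inf x) * (𝒢.lnf x).2.prod ∧ 𝒢.LW (𝒢.lnf x).2 :=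
  Classical.choose_spec (𝒢.lnf_exists x)

theorem pos_inf {a : G} (ha : a ∈ 𝒢.pos) : 0 ≤ 𝒢.inf a := by
  by_contra hlt
  push Not at hlt
  obtain ⟨h1, h2⟩ := 𝒢.lnf_spec_s5 a
  obtain ⟨k, hk⟩ : ∃ k : ℕ, 𝒢.inf a = -(k : ℤ) := ⟨(-𝒢.inf a).toNat, by omega⟩
  apply h2.not_dvd 𝒢 (k := k) (by omega)
  rw [← hk, ← h1]; exact ha

theorem pos_closure {a : G} (ha : a ∈ 𝒢.pos) :
    a ∈ Submonoid.closure {s : G | Simple 𝒢.pos 𝒢.Δ s} := by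
  obtain ⟨h1, h2⟩ := 𝒢.lnf_spec_s5 a
  have h0 := 𝒢.pos_inf ha
  obtain ⟨k, hk⟩ := Int.eq_ofNat_of_zero_le h0
  rw [h1, hk, zpow_natCast]
  refine Submonoid.mul_mem _ (Submonoid.pow_mem _ (Submonoid.subset_closure ?_) _) ?_
  · exact ⟨𝒢.Δ_pos, by simp [LeftDvd, 𝒢.pos.one_mem]⟩
  · exact Submonoid.list_prod_mem _ fun s hs => Submonoid.subset_closure (h2.1 s hs).1

theorem closure_pos {a : G}
    (ha : a ∈ Submonoid.closure {s : G | Simple 𝒢.pos 𝒢.Δ s}) : a ∈ 𝒢.pos := by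
  have h : Submonoid.closure {s : G | Simple 𝒢.pos 𝒢.Δ s} ≤ 𝒢.pos :=
    Submonoid.closure_le.2 fun s (hs : Simple 𝒢.pos 𝒢.Δ s) => hs.1
  exact h ha

theorem conj_one {a : G} (ha : a ∈ 𝒢.pos) : 𝒢.Δ⁻¹ * a * 𝒢.Δ ∈ 𝒢.pos := by
  induction 𝒢.pos_closure ha using Submonoid.closure_induction with
  | mem s hs =>
    have := (𝒢.compl_simple (𝒢.compl_simple hs)).1
    simpa [mul_assoc] using this
  | one => simp [𝒢.pos.one_mem]
  | mul a b h1 h2 iha ihb =>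
    have h1' : a ∈ 𝒢.pos := 𝒢.closure_pos h1
    have h2' : b ∈ 𝒢.pos := 𝒢.closure_pos h2
    have := 𝒢.pos.mul_mem (iha h1') (ihb h2')
    simpa [mul_assoc] using this

theorem conj_neg_one {a : G} (ha : a ∈ 𝒢.pos) : 𝒢.Δ * a * 𝒢.Δ⁻¹ ∈ 𝒢.pos := by
  induction 𝒢.pos_closure ha using Submonoid.closure_induction with
  | mem s hs =>
    have := (𝒢.compl_simple' (𝒢.compl_simple' hs)).1
    simpa [mul_assoc] using this
  | one => simp [𝒢.pos.one_mem]
  | mul a b h1 h2 iha ihb =>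
    have h1' : a ∈ 𝒢.pos := 𝒢.closure_pos h1
    have h2' : b ∈ 𝒢.pos := 𝒢.closure_pos h2
    have := 𝒢.pos.mul_mem (iha h1') (ihb h2')
    simpa [mul_assoc] using this

theorem tau_add (j k : ℤ) (a : G) : 𝒢.tau j (𝒢.tau k a) = 𝒢.tau (k + j) a := by
  simp only [tau, zpow_add, neg_add_rev, mul_assoc]

theorem tau_zero (a : G) : 𝒢.tau 0 a = a := by simp [tau]

theorem tau_mul (k : ℤ) (a b : G) : 𝒢.tau k (a * b) = 𝒢.tau k a * 𝒢.tau k b := by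
  simp [tau, mul_assoc]

theorem tau_inv (k : ℤ) (a : G) : 𝒢.tau k a⁻¹ = (𝒢.tau k a)⁻¹ := by
  simp [tau, mul_assoc]

theorem tau_one (k : ℤ) : 𝒢.tau k 1 = 1 := by simp [tau]

theorem tau_Δ (k : ℤ) : 𝒢.tau k 𝒢.Δ = 𝒢.Δ := by
  rw [tau, ← zpow_add_one, ← zpow_add]; simp

theorem tau_pos (k : ℤ) {a : G} (ha : a ∈ 𝒢.pos) : 𝒢.tau k a ∈ 𝒢.pos := by
  induction k using Int.induction_on with
  | zero => simpa [tau_zero] using ha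
  | succ i ih =>
    rw [← 𝒢.tau_add 1 i]
    simpa [tau] using 𝒢.conj_one ih
  | pred i ih =>
    rw [sub_eq_add_neg, ← 𝒢.tau_add (-1) (-i)]
    simpa [tau] using 𝒢.conj_neg_one ih

theorem tau_pos_iff (k : ℤ) {a : G} : 𝒢.tau k a ∈ 𝒢.pos ↔ a ∈ 𝒢.pos := by
  refine ⟨fun h => ?_, 𝒢.tau_pos k⟩
  have := 𝒢.tau_pos (-k) h
  rwa [tau_add, add_neg_cancel, tau_zero] at this

theorem tau_dvd (k : ℤ) {a b : G} (h : LeftDvd 𝒢.pos a b) :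
    LeftDvd 𝒢.pos (𝒢.tau k a) (𝒢.tau k b) := by
  have := 𝒢.tau_pos k h
  rwa [tau_mul, tau_inv] at this

theorem tau_dvdR (k : ℤ) {a b : G} (h : RightDvd 𝒢.pos a b) :
    RightDvd 𝒢.pos (𝒢.tau k a) (𝒢.tau k b) := by
  have := 𝒢.tau_pos k h
  rwa [tau_mul, tau_inv] at this

theorem tau_gcdL (k : ℤ) (a b : G) :
    𝒢.gcdL (𝒢.tau k a) (𝒢.tau k b) = 𝒢.tau k (𝒢.gcdL a b) := by
  apply 𝒢.dvd_antisymm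
  · have : LeftDvd 𝒢.pos (𝒢.tau (-k) (𝒢.gcdL (𝒢.tau k a) (𝒢.tau k b))) (𝒢.gcdL a b) := by
      apply 𝒢.dvd_gcdL
      · simpa [tau_add, tau_zero] using 𝒢.tau_dvd (-k) (𝒢.gcdL_dvd_left (𝒢.tau k a) (𝒢.tau k b))
      · simpa [tau_add, tau_zero] using 𝒢.tau_dvd (-k) (𝒢.gcdL_dvd_right (𝒢.tau k a) (𝒢.tau k b))
    simpa [tau_add, tau_zero] using 𝒢.tau_dvd k this
  · exact 𝒢.dvd_gcdL _ _ _ (𝒢.tau_dvd k (𝒢.gcdL_dvd_left _ _))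
      (𝒢.tau_dvd k (𝒢.gcdL_dvd_right _ _))

theorem tau_gcdR (k : ℤ) (a b : G) :
    𝒢.gcdR (𝒢.tau k a) (𝒢.tau k b) = 𝒢.tau k (𝒢.gcdR a b) := by
  apply 𝒢.dvdR_antisymm
  · have : RightDvd 𝒢.pos (𝒢.tau (-k) (𝒢.gcdR (𝒢.tau k a) (𝒢.tau k b))) (𝒢.gcdR a b) := by
      apply 𝒢.dvd_gcdR
      · simpa [tau_add, tau_zero] using 𝒢.tau_dvdR (-k) (𝒢.gcdR_dvd_left (𝒢.tau k a) (𝒢.tau k b))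
      · simpa [tau_add, tau_zero] using 𝒢.tau_dvdR (-k) (𝒢.gcdR_dvd_right (𝒢.tau k a) (𝒢.tau k b))
    simpa [tau_add, tau_zero] using 𝒢.tau_dvdR k this
  · exact 𝒢.dvd_gcdR _ _ _ (𝒢.tau_dvdR k (𝒢.gcdR_dvd_left _ _))
      (𝒢.tau_dvdR k (𝒢.gcdR_dvd_right _ _))

theorem tau_inj (k : ℤ) {a b : G} (h : 𝒢.tau k a = 𝒢.tau k b) : a = b := by
  have := congrArg (𝒢.tau (-k)) h
  simpa [tau_add, tau_zero] using this

theorem tau_proper (k : ℤ) {s : G} (h : Simple 𝒢.pos 𝒢.Δ s ∧ s ≠ 1 ∧ s ≠ 𝒢.Δ) :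
    Simple 𝒢.pos 𝒢.Δ (𝒢.tau k s) ∧ 𝒢.tau k s ≠ 1 ∧ 𝒢.tau k s ≠ 𝒢.Δ := by
  refine ⟨⟨𝒢.tau_pos k h.1.1, ?_⟩, ?_, ?_⟩
  · have := 𝒢.tau_dvd k h.1.2
    rwa [tau_Δ] at this
  · intro e; exact h.2.1 (𝒢.tau_inj k (by rw [e, tau_one]))
  · intro e; exact h.2.2 (𝒢.tau_inj k (by rw [e, tau_Δ]))

theorem tau_list_prod (k : ℤ) (l : List G) : 𝒢.tau k l.prod = (l.map (𝒢.tau k)).prod := by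
  induction l with
  | nil => simp [tau_one]
  | cons a l ih => simp [tau_mul, ih]

theorem zpow_mul_tau (k : ℤ) (a : G) : 𝒢.Δ ^ k * 𝒢.tau k a = a * 𝒢.Δ ^ k := by
  simp [tau, ← mul_assoc]

/-! ### Infimum and supremum as order-theoretic bounds -/

theorem le_inf_iff (x : G) (q : ℤ) : q ≤ 𝒢.inf x ↔ 𝒢.Δ ^ (-q) * x ∈ 𝒢.pos := by
  obtain ⟨h1, h2⟩ := 𝒢.lnf_spec_s5 x
  have e : 𝒢.Δ ^ (-q) * x = 𝒢.Δ ^ (𝒢.inf x - q) * (𝒢.lnf x).2.prod := by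
    conv_lhs => rw [h1]
    rw [← mul_assoc, ← zpow_add]; congr 2; ring
  rw [e]
  constructor
  · intro h
    obtain ⟨k, hk⟩ := Int.eq_ofNat_of_zero_le (sub_nonneg.2 h)
    rw [hk, zpow_natCast]
    exact 𝒢.pos.mul_mem (𝒢.pos.pow_mem 𝒢.Δ_pos k) (h2.pos 𝒢)
  · intro h
    by_contra hlt
    push Not at hlt
    obtain ⟨k, hk⟩ : ∃ k : ℕ, 𝒢.inf x - q = -(k : ℤ) := ⟨(q - 𝒢.inf x).toNat, by omega⟩
    exact h2.not_dvd 𝒢 (k := k) (by omega) (by rw [← hk]; exact h)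

theorem inf_mul (x y : G) : 𝒢.inf x + 𝒢.inf y ≤ 𝒢.inf (x * y) := by
  rw [le_inf_iff]
  have h1 := (𝒢.le_inf_iff x _).1 le_rfl
  have h2 := (𝒢.le_inf_iff y _).1 le_rfl
  have := 𝒢.pos.mul_mem (𝒢.tau_pos (𝒢.inf y) h1) h2
  convert this using 1
  simp [tau, mul_assoc, zpow_add]

theorem prod_dvd_pow {l : List G} (h : ∀ s ∈ l, Simple 𝒢.pos 𝒢.Δ s) :
    l.prod⁻¹ * 𝒢.Δ ^ l.length ∈ 𝒢.pos := by
  induction l with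
  | nil => simp [𝒢.pos.one_mem]
  | cons a l ih =>
    have h1 := ih fun s hs => h s (List.mem_cons_of_mem _ hs)
    have h2 := 𝒢.tau_pos l.length (h a (by simp)).2
    have := 𝒢.pos.mul_mem h1 h2
    convert this using 1
    simp [tau, mul_assoc, pow_succ']

theorem LW.length_le {l : List G} (h : 𝒢.LW l) (n : ℕ)
    (hn : l.prod⁻¹ * 𝒢.Δ ^ n ∈ 𝒢.pos) : l.length ≤ n := by
  induction n generalizing l with
  | zero =>
    cases l with
    | nil => simp
    | cons a l =>
      exfalso
      have ha := h.1 a (by simp)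
      apply ha.2.1
      apply 𝒢.pos_antisymm _ ha.1.1
      have := 𝒢.pos.mul_mem (h.tail.pos 𝒢) hn
      simpa [mul_assoc] using this
  | succ n ih =>
    cases l with
    | nil => simp
    | cons a l =>
      simp only [List.length_cons, add_le_add_iff_right]
      apply ih h.tail
      -- `b ≼ (b ∧ Δ) Δ^n`, i.e. `b Δ^(-n)` divides both `b` and `Δ`
      have hd : LeftDvd 𝒢.pos ((a :: l).prod * (𝒢.Δ ^ n)⁻¹) a := by
        apply h.dvd_head
        · simpa [LeftDvd, mul_assoc] using 𝒢.pos.pow_mem 𝒢.Δ_pos n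
        · have := 𝒢.tau_pos (-n) hn
          simpa [LeftDvd, tau, mul_assoc, pow_succ'] using this
      have := 𝒢.tau_pos n hd
      simpa [tau, mul_assoc] using this

theorem sup_le_iff (x : G) (q : ℤ) : 𝒢.sup x ≤ q ↔ x⁻¹ * 𝒢.Δ ^ q ∈ 𝒢.pos := by
  obtain ⟨h1, h2⟩ := 𝒢.lnf_spec_s5 x
  have e : x⁻¹ * 𝒢.Δ ^ q = (𝒢.lnf x).2.prod⁻¹ * 𝒢.Δ ^ (q - 𝒢.inf x) := by
    conv_lhs => rw [h1]
    rw [mul_inv_rev, mul_assoc, ← zpow_neg, ← zpow_add]; congr 2; ring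
  rw [e]
  have hs : 𝒢.sup x = 𝒢.inf x + ((𝒢.lnf x).2.length : ℤ) := rfl
  rw [hs]
  constructor
  · intro h
    obtain ⟨k, hk⟩ : ∃ k : ℕ, q - 𝒢.inf x = (((𝒢.lnf x).2.length + k : ℕ) : ℤ) :=
      ⟨(q - 𝒢.inf x - (𝒢.lnf x).2.length).toNat, by omega⟩
    rw [hk, zpow_natCast, pow_add, ← mul_assoc]
    exact 𝒢.pos.mul_mem (𝒢.prod_dvd_pow fun s hs => (h2.1 s hs).1) (𝒢.pos.pow_mem 𝒢.Δ_pos k)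
  · intro h
    rcases le_or_gt 0 (q - 𝒢.inf x) with hq | hq
    · obtain ⟨k, hk⟩ := Int.eq_ofNat_of_zero_le hq
      rw [hk, zpow_natCast] at h
      have := h2.length_le 𝒢 k h
      omega
    · exfalso
      obtain ⟨k, hk⟩ : ∃ k : ℕ, q - 𝒢.inf x = -(k : ℤ) := ⟨(𝒢.inf x - q).toNat, by omega⟩
      have h3 := 𝒢.pos.mul_mem (h2.pos 𝒢) h
      rw [mul_inv_cancel_left, hk] at h3
      have h4 := 𝒢.pos_antisymm (𝒢.Δ ^ k) (𝒢.pos.pow_mem 𝒢.Δ_pos k) (by simpa using h3)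
      exact 𝒢.zpow_ne (n := k) (by omega) (by simpa using h4)

theorem sup_mul (x y : G) : 𝒢.sup (x * y) ≤ 𝒢.sup x + 𝒢.sup y := by
  rw [sup_le_iff]
  have h1 := (𝒢.sup_le_iff x _).1 le_rfl
  have h2 := (𝒢.sup_le_iff y _).1 le_rfl
  have := 𝒢.pos.mul_mem h2 (𝒢.tau_pos (𝒢.sup y) h1)
  convert this using 1
  simp [tau, mul_assoc, zpow_add]

theorem inf_pow (x : G) (m : ℕ) : ((m + 1 : ℕ) : ℤ) * 𝒢.inf x ≤ 𝒢.inf (x ^ (m + 1)) := by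
  induction m with
  | zero => simp
  | succ m ih =>
    rw [pow_succ _ (m + 1)]
    have := 𝒢.inf_mul (x ^ (m + 1)) x
    push_cast at *
    linarith

theorem sup_pow (x : G) (m : ℕ) : 𝒢.sup (x ^ (m + 1)) ≤ ((m + 1 : ℕ) : ℤ) * 𝒢.sup x := by
  induction m with
  | zero => simp
  | succ m ih =>
    rw [pow_succ _ (m + 1)]
    have := 𝒢.sup_mul (x ^ (m + 1)) x
    push_cast at *
    linarith

theorem le_of_forall_mul_le {a b C : ℤ}
    (h : ∀ m : ℕ, ((m + 1 : ℕ) : ℤ) * a ≤ ((m + 1 : ℕ) : ℤ) * b + C) : a ≤ b := by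
  by_contra hlt
  push Not at hlt
  have h1 := h C.natAbs
  push_cast at h1
  have h2 : C ≤ |C| := le_abs_self C
  nlinarith [abs_nonneg C]

/-- A periodically geodesic element has maximal infimum and minimal supremum
in its conjugacy class. -/
theorem PeriodicallyGeodesic.bounds {x y : G} (hy : 𝒢.PeriodicallyGeodesic y)
    (hc : IsConj x y) : 𝒢.inf x ≤ 𝒢.inf y ∧ 𝒢.sup y ≤ 𝒢.sup x := by
  obtain ⟨c, rfl⟩ := isConj_iff.1 hc
  constructor
  · apply le_of_forall_mul_le (C := -𝒢.inf c - 𝒢.inf c⁻¹)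
    intro m
    rw [← (hy (m + 1) (by omega)).1, conj_pow]
    have h1 := 𝒢.inf_mul (c * x ^ (m + 1)) c⁻¹
    have h2 := 𝒢.inf_mul c (x ^ (m + 1))
    have h3 := 𝒢.inf_pow x m
    linarith
  · apply le_of_forall_mul_le (C := 𝒢.sup c + 𝒢.sup c⁻¹)
    intro m
    rw [← (hy (m + 1) (by omega)).2, conj_pow]
    have h1 := 𝒢.sup_mul (c * x ^ (m + 1)) c⁻¹
    have h2 := 𝒢.sup_mul c (x ^ (m + 1))
    have h3 := 𝒢.sup_pow x m
    linarith

theorem PeriodicallyGeodesic.pow {y : G} (hy : 𝒢.PeriodicallyGeodesic y) (m : ℕ)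
    (hm : 1 ≤ m) : 𝒢.PeriodicallyGeodesic (y ^ m) := by
  intro k hk
  have h1 := hy (m * k) (Nat.mul_pos hm hk)
  have h2 := hy m hm
  rw [← pow_mul, h1.1, h1.2, h2.1, h2.2]
  push_cast
  constructor <;> ring

/-- Criterion: powers with the expected infimum and length. -/
theorem PeriodicallyGeodesic.of_len {y : G}
    (h : ∀ m : ℕ, 𝒢.inf (y ^ (m + 1)) = ((m + 1 : ℕ) : ℤ) * 𝒢.inf y ∧
      𝒢.len (y ^ (m + 1)) = (m + 1) * 𝒢.len y) : 𝒢.PeriodicallyGeodesic y := by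
  intro m hm
  obtain ⟨k, rfl⟩ : ∃ k, m = k + 1 := ⟨m - 1, by omega⟩
  refine ⟨(h k).1, ?_⟩
  rw [sup, sup, (h k).1, (h k).2]
  push_cast; ring

theorem tau_leftWeighted (k : ℤ) {s t : G} (h : 𝒢.gcdL (s * t) 𝒢.Δ = s) :
    𝒢.gcdL (𝒢.tau k s * 𝒢.tau k t) 𝒢.Δ = 𝒢.tau k s := by
  have := 𝒢.tau_gcdL k (s * t) 𝒢.Δ
  rwa [tau_mul, tau_Δ, h] at this

theorem tau_rightWeighted (k : ℤ) {s t : G} (h : 𝒢.gcdR (s * t) 𝒢.Δ = t) :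
    𝒢.gcdR (𝒢.tau k s * 𝒢.tau k t) 𝒢.Δ = 𝒢.tau k t := by
  have := 𝒢.tau_gcdR k (s * t) 𝒢.Δ
  rwa [tau_mul, tau_Δ, h] at this

theorem LeftRigid.periodicallyGeodesic {y : G} (hy : 𝒢.LeftRigid y) :
    𝒢.PeriodicallyGeodesic y := by
  obtain ⟨hne, -, -, hch⟩ := hy
  obtain ⟨hprod, hsimp, hchain⟩ := 𝒢.lnf_spec_s5 y
  have hp : (𝒢.lnf y).1 = 𝒢.inf y := rfl
  have hlen : 𝒢.len y = (𝒢.lnf y).2.length := rfl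
  rw [iotaL, hp] at hch
  set l := (𝒢.lnf y).2 with hl
  set p := 𝒢.inf y with hpdef
  have key : ∀ m : ℕ, ∃ L : List G, L.length = (m + 1) * l.length ∧
      L.getLast? = l.getLast? ∧
      IsLeftNF 𝒢.pos 𝒢.Δ 𝒢.gcdL (((m + 1 : ℕ) : ℤ) * p) L (y ^ (m + 1)) := by
    intro m
    induction m with
    | zero => exact ⟨l, by simp, rfl, by simpa using hprod, hsimp, hchain⟩
    | succ m ih =>
      obtain ⟨L, hL1, hL2, hL3, hL4, hL5⟩ := ih
      refine ⟨L.map (𝒢.tau p) ++ l, ?_, ?_, ?_, ?_, ?_⟩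
      · simp [hL1]; ring
      · exact List.getLast?_append_of_ne_nil _ hne
      · rw [pow_succ _ (m + 1), hL3, List.prod_append, ← tau_list_prod]
        conv_lhs => rw [hprod]
        rw [mul_assoc, ← mul_assoc L.prod, ← zpow_mul_tau, ← mul_assoc, ← mul_assoc, ← zpow_add,
          mul_assoc]
        congr 2
        push_cast; ring
      · intro s hs
        rcases List.mem_append.1 hs with hs | hs
        · obtain ⟨t, ht, rfl⟩ := List.mem_map.1 hs
          exact 𝒢.tau_proper p (hL4 t ht)
        · exact hsimp s hs
      · refine List.isChain_append.2 ⟨?_, hchain, ?_⟩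
        · rw [List.isChain_map]
          exact List.IsChain.imp (fun a b h => 𝒢.tau_leftWeighted p h) hL5
        · intro a ha b hb
          rw [List.getLast?_map, hL2] at ha
          obtain ⟨a', ha', rfl⟩ := Option.map_eq_some_iff.1 ha
          have h1 := (List.isChain_append.1 hch).2.2 a' ha' (𝒢.tau (-p) (l.headD 1)) (by simp)
          have hb' : l.headD 1 = b := by
            rw [List.headD_eq_head?_getD, hb]; rfl
          have h2 := 𝒢.tau_leftWeighted p h1
          rw [tau_add, neg_add_cancel, tau_zero, hb'] at h2
          exact h2
  apply PeriodicallyGeodesic.of_len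
  intro m
  obtain ⟨L, hL1, -, hL⟩ := key m
  have := 𝒢.inf_of_lnf hL
  exact ⟨this.1, by rw [this.2, hL1, hlen]⟩

theorem RightRigid.periodicallyGeodesic {y : G} (hy : 𝒢.RightRigid y) :
    𝒢.PeriodicallyGeodesic y := by
  obtain ⟨hne, -, -, hch⟩ := hy
  have hspec : IsRightNF 𝒢.pos 𝒢.Δ 𝒢.gcdR (𝒢.rnf y).1 (𝒢.rnf y).2 y :=
    Classical.choose_spec (𝒢.rnf_exists y)
  obtain ⟨hp, hlen⟩ := 𝒢.inf_of_rnf hspec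
  obtain ⟨hprod, hsimp, hchain⟩ := hspec
  rw [iotaR] at hch
  rw [← hp] at hch hprod
  set l := (𝒢.rnf y).2 with hl
  set p := 𝒢.inf y with hpdef
  have key : ∀ m : ℕ, ∃ L : List G, L.length = (m + 1) * l.length ∧
      L.head? = l.head? ∧
      IsRightNF 𝒢.pos 𝒢.Δ 𝒢.gcdR (((m + 1 : ℕ) : ℤ) * p) L (y ^ (m + 1)) := by
    intro m
    induction m with
    | zero => exact ⟨l, by simp, rfl, by simpa using hprod, hsimp, hchain⟩
    | succ m ih =>
      obtain ⟨L, hL1, hL2, hL3, hL4, hL5⟩ := ih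
      refine ⟨l ++ L.map (𝒢.tau (-p)), ?_, ?_, ?_, ?_, ?_⟩
      · simp [hL1]; ring
      · exact List.head?_append_of_ne_nil _ hne
      · rw [pow_succ' _ (m + 1), hL3, List.prod_append, ← tau_list_prod]
        conv_lhs => rw [hprod]
        have e : ((m + 1 + 1 : ℕ) : ℤ) * p = p + ((m + 1 : ℕ) : ℤ) * p := by push_cast; ring
        rw [e, zpow_add]
        simp [tau, mul_assoc]
      · intro s hs
        rcases List.mem_append.1 hs with hs | hs
        · exact hsimp s hs
        · obtain ⟨t, ht, rfl⟩ := List.mem_map.1 hs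
          exact 𝒢.tau_proper (-p) (hL4 t ht)
      · refine List.isChain_append.2 ⟨hchain, ?_, ?_⟩
        · rw [List.isChain_map]
          exact List.IsChain.imp (fun a b h => 𝒢.tau_rightWeighted (-p) h) hL5
        · intro a ha b hb
          rw [List.head?_map, hL2] at hb
          obtain ⟨b', hb', rfl⟩ := Option.map_eq_some_iff.1 hb
          have h1 := (List.isChain_cons.1 hch).1 b' hb'
          have ha' : l.getLast?.getD 1 = a := by
            rw [ha]; rfl
          have h2 := 𝒢.tau_rightWeighted (-p) h1
          rw [tau_add, add_neg_cancel, tau_zero, ha'] at h2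
          exact h2
  apply PeriodicallyGeodesic.of_len
  intro m
  obtain ⟨L, hL1, -, hL⟩ := key m
  have := 𝒢.inf_of_rnf hL
  exact ⟨this.1, by rw [this.2, hL1, hlen]⟩

end GarsideGroup

/-- **Lemma 4.2.** If `x ∈ SSS(x)` in a Garside group `G`, and `x` is conjugate
to a (left or right) rigid element, then `x` is periodically geodesic. -/
theorem periodicallyGeodesic_of_conj_rigid {G : Type*} [Group G] (𝒢 : GarsideGroup G)
    (x : G) (hx : x ∈ 𝒢.SSS x)
    (h : ∃ y, IsConj x y ∧ (𝒢.LeftRigid y ∨ 𝒢.RightRigid y)) :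
    𝒢.PeriodicallyGeodesic x := by
  obtain ⟨y, hc, hr⟩ := h
  have hy : 𝒢.PeriodicallyGeodesic y :=
    hr.elim (fun h => h.periodicallyGeodesic) (fun h => h.periodicallyGeodesic)
  obtain ⟨h1, h2⟩ := hy.bounds 𝒢 hc
  have h3 : 𝒢.len x ≤ 𝒢.len y := hx.2 y hc
  have hsx : 𝒢.sup x = 𝒢.inf x + 𝒢.len x := rfl
  have hsy : 𝒢.sup y = 𝒢.inf y + 𝒢.len y := rfl
  have hi : 𝒢.inf x = 𝒢.inf y := by omega
  have hs : 𝒢.sup x = 𝒢.sup y := by omega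
  intro m hm
  have hcm : IsConj (x ^ m) (y ^ m) := by
    obtain ⟨c, rfl⟩ := isConj_iff.1 hc
    exact isConj_iff.2 ⟨c, conj_pow.symm⟩
  obtain ⟨h4, h5⟩ := (hy.pow 𝒢 m hm).bounds 𝒢 hcm
  rw [(hy m hm).1, ← hi] at h4
  rw [(hy m hm).2, ← hs] at h5
  obtain ⟨k, rfl⟩ : ∃ k, m = k + 1 := ⟨m - 1, by omega⟩
  exact ⟨le_antisymm h4 (𝒢.inf_pow x k), le_antisymm (𝒢.sup_pow x k) h5⟩

end Garside
end
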